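/- arXiv:1508.06142 — 9 statements merged into one kernel-verified Lean document; each statement's English description precedes it below -/
import Mathlib

section
/- Let 𝔥 ∈ (0,1) and s > 0. For every a ∈ ℝ with a ≠ 0 and every u ∈ ℝ with u ≠ 0, the Lebesgue integral I(ε) := ∫_ℝ |exp(i·u·(r − a/ε^s)) − 1| / (|r − a/ε^s| · |r|^{1−𝔥}) dr is finite for every ε ∈ (0,1), and I(ε) → 0 as ε → 0⁺. -/
open MeasureTheory Filter

lemma fp_g (u x : ℝ) :
    ‖Complex.exp (Complex.I * ((u * x : ℝ) : ℂ)) - 1‖ / |x| ≤ (|u| + 2) * (1 + |x|) ^ (-1 : ℝ) := by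
  have hx := abs_nonneg x
  have h1 : ‖Complex.exp (Complex.I * ((u * x : ℝ) : ℂ)) - 1‖ ≤ |u| * |x| := by
    have := Real.norm_exp_I_mul_ofReal_sub_one_le (x := u * x)
    rwa [Real.norm_eq_abs, abs_mul] at this
  have h2 : ‖Complex.exp (Complex.I * ((u * x : ℝ) : ℂ)) - 1‖ ≤ 2 := by
    refine (norm_sub_le _ _).trans ?_
    rw [mul_comm, Complex.norm_exp_ofReal_mul_I]
    norm_num
  have h3 : ‖Complex.exp (Complex.I * ((u * x : ℝ) : ℂ)) - 1‖ / |x| ≤ |u| :=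
    div_le_of_le_mul₀ hx (abs_nonneg u) h1
  rw [Real.rpow_neg_one, ← div_eq_mul_inv, le_div_iff₀ (by positivity), mul_add, mul_one]
  have h4 : ‖Complex.exp (Complex.I * ((u * x : ℝ) : ℂ)) - 1‖ / |x| * |x| ≤ 2 := by
    rcases eq_or_ne |x| 0 with h | h
    · rw [h]; norm_num
    · rwa [div_mul_cancel₀ _ h]
  linarith

lemma fp_xy (x y P Q : ℝ) (hx : 1 ≤ x) (hy : 1 ≤ y) (hP : 0 < P) (hQ : 0 < Q) :
    x ^ (-P) * y ^ (-Q) ≤ x ^ (-(P + Q)) + y ^ (-(P + Q)) := by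
  have hx0 : 0 < x := by linarith
  have hy0 : 0 < y := by linarith
  rw [neg_add, Real.rpow_add hx0, Real.rpow_add hy0]
  rcases le_total x y with h | h
  · have := Real.rpow_le_rpow_of_nonpos hx0 h (by linarith : -Q ≤ 0)
    have h2 : x ^ (-P) * y ^ (-Q) ≤ x ^ (-P) * x ^ (-Q) := by gcongr
    have : 0 ≤ y ^ (-P) * y ^ (-Q) := by positivity
    linarith
  · have := Real.rpow_le_rpow_of_nonpos hy0 h (by linarith : -P ≤ 0)
    have h2 : x ^ (-P) * y ^ (-Q) ≤ y ^ (-P) * y ^ (-Q) := by gcongr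
    have : 0 ≤ x ^ (-P) * x ^ (-Q) := by positivity
    linarith

lemma fp_main (h r b : ℝ) (h0 : 0 < h) (h1 : h < 1) :
    (1 + |r - b|) ^ (-1 : ℝ) * |r| ^ (h - 1) ≤
      2 * (1 + |b|) ^ (-((1 - h) / 4)) *
        ((Set.Iic (1:ℝ)).indicator (fun y => y ^ (h - 1)) |r| +
          ((1 + |r - b|) ^ (-(3 / 2 - h / 2)) + (1 + |r|) ^ (-(3 / 2 - h / 2)))) := by
  have hx : 1 ≤ 1 + |r - b| := by linarith [abs_nonneg (r - b)]
  have hy : 1 ≤ 1 + |r| := by linarith [abs_nonneg r]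
  have hb : 1 ≤ 1 + |b| := by linarith [abs_nonneg b]
  have hB : 1 + |b| ≤ (1 + |r - b|) * (1 + |r|) := by
    have : |b| ≤ |r| + |r - b| := by
      have := abs_sub r (r - b)
      simpa using this
    nlinarith [abs_nonneg (r - b), abs_nonneg r, mul_nonneg (abs_nonneg (r - b)) (abs_nonneg r)]
  have hxy := fp_xy _ _ (1 - (1 - h) / 4) (1 - h - (1 - h) / 4) hx hy (by linarith) (by linarith)
  rw [show 1 - (1 - h) / 4 + (1 - h - (1 - h) / 4) = 3 / 2 - h / 2 by ring] at hxy
  set x := 1 + |r - b| with hxd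
  set y := 1 + |r| with hyd
  set B := 1 + |b| with hBd
  have hx0 : 0 < x := by linarith
  have hy0 : 0 < y := by linarith
  have hB0 : 0 < B := by linarith
  by_cases hr : |r| ≤ 1
  · rw [Set.indicator_of_mem (by exact hr)]
    have e1 : x ^ (-1 : ℝ) ≤ 2 * B ^ (-((1 - h) / 4)) := by
      have e2 : B ^ (-1 : ℝ) ≤ B ^ (-((1 - h) / 4)) :=
        Real.rpow_le_rpow_of_exponent_le hb (by linarith)
      refine le_trans ?_ (mul_le_mul_of_nonneg_left e2 (by norm_num))
      rw [Real.rpow_neg_one, Real.rpow_neg_one, ← div_eq_mul_inv, inv_eq_one_div,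
        div_le_div_iff₀ hx0 hB0]
      nlinarith
    calc _ ≤ 2 * B ^ (-((1 - h) / 4)) * |r| ^ (h - 1) := by gcongr
      _ ≤ _ := by
        gcongr
        have : 0 ≤ x ^ (-(3 / 2 - h / 2)) + y ^ (-(3 / 2 - h / 2)) := by positivity
        linarith
  · rw [Set.indicator_of_notMem (by exact hr), zero_add]
    push Not at hr
    have e1 : |r| ^ (h - 1) ≤ 2 * y ^ (h - 1) := by
      have e2 : |r| ^ (h - 1) ≤ (y / 2) ^ (h - 1) :=
        Real.rpow_le_rpow_of_nonpos (by positivity) (by linarith) (by linarith)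
      rw [Real.div_rpow hy0.le (by norm_num), div_eq_mul_inv, ← Real.rpow_neg (by norm_num)] at e2
      have e3 : (2:ℝ) ^ (-(h - 1)) ≤ 2 ^ (1:ℝ) :=
        Real.rpow_le_rpow_of_exponent_le (by norm_num) (by linarith)
      rw [Real.rpow_one] at e3
      have : 0 ≤ y ^ (h - 1) := by positivity
      nlinarith
    have e4 : (x * y) ^ (-((1 - h) / 4)) ≤ B ^ (-((1 - h) / 4)) :=
      Real.rpow_le_rpow_of_nonpos hB0 hB (by linarith)
    calc x ^ (-1 : ℝ) * |r| ^ (h - 1) ≤ x ^ (-1 : ℝ) * (2 * y ^ (h - 1)) := by gcongr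
      _ = 2 * (x * y) ^ (-((1 - h) / 4)) *
          (x ^ (-(1 - (1 - h) / 4)) * y ^ (-(1 - h - (1 - h) / 4))) := by
        rw [Real.mul_rpow hx0.le hy0.le,
          show (-1 : ℝ) = -((1 - h) / 4) + -(1 - (1 - h) / 4) by ring,
          show h - 1 = -((1 - h) / 4) + -(1 - h - (1 - h) / 4) by ring,
          Real.rpow_add hx0, Real.rpow_add hy0]
        ring_nf
      _ ≤ _ := by gcongr

lemma fp_bound (h u r b : ℝ) (h0 : 0 < h) (h1 : h < 1) :
    ‖Complex.exp (Complex.I * ((u * (r - b) : ℝ) : ℂ)) - 1‖ / (|r - b| * |r| ^ (1 - h)) ≤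
      (|u| + 2) * (2 * (1 + |b|) ^ (-((1 - h) / 4)) *
        ((Set.Iic (1:ℝ)).indicator (fun y => y ^ (h - 1)) |r| +
          ((1 + |r - b|) ^ (-(3 / 2 - h / 2)) + (1 + |r|) ^ (-(3 / 2 - h / 2))))) := by
  have e : (|r| ^ (1 - h))⁻¹ = |r| ^ (h - 1) := by
    rw [← Real.rpow_neg (abs_nonneg r), neg_sub]
  rw [← div_div, div_eq_mul_inv _ (|r| ^ (1 - h)), e]
  have hp : 0 ≤ |r| ^ (h - 1) := by positivity
  calc _ ≤ (|u| + 2) * (1 + |r - b|) ^ (-1 : ℝ) * |r| ^ (h - 1) :=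
        mul_le_mul_of_nonneg_right (fp_g u (r - b)) hp
    _ = (|u| + 2) * ((1 + |r - b|) ^ (-1 : ℝ) * |r| ^ (h - 1)) := by ring
    _ ≤ _ := mul_le_mul_of_nonneg_left (fp_main h r b h0 h1) (by positivity)

lemma fp_int1 (h : ℝ) (h0 : 0 < h) :
    Integrable (fun r : ℝ => (Set.Iic (1:ℝ)).indicator (fun y => y ^ (h - 1)) |r|) := by
  have : IntegrableOn ((Set.Iic (1:ℝ)).indicator (fun y : ℝ => y ^ (h - 1))) (Set.Ioi 0) := by
    rw [IntegrableOn, integrable_indicator_iff measurableSet_Iic, IntegrableOn,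
      Measure.restrict_restrict measurableSet_Iic, Set.inter_comm, Set.Ioi_inter_Iic]
    have := intervalIntegral.intervalIntegrable_rpow' (a := 0) (b := 1) (r := h - 1) (by linarith)
    rwa [intervalIntegrable_iff_integrableOn_Ioc_of_le (by norm_num)] at this
  have e1 : IntegrableOn (fun r : ℝ => (Set.Iic (1:ℝ)).indicator (fun y => y ^ (h - 1)) |r|)
      (Set.Ioi 0) := by
    refine this.congr_fun (fun r hr => ?_) measurableSet_Ioi
    simp only [abs_of_pos (Set.mem_Ioi.1 hr)]
  have e2 : IntegrableOn (fun r : ℝ => (Set.Iic (1:ℝ)).indicator (fun y => y ^ (h - 1)) |r|)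
      (Set.Iic 0) := by
    rw [← Measure.map_neg_eq_self (volume : Measure ℝ)]
    let m : MeasurableEmbedding fun x : ℝ => -x := (Homeomorph.neg ℝ).measurableEmbedding
    rw [m.integrableOn_map_iff]
    simp_rw [Function.comp_def, abs_neg, Set.neg_preimage, Set.neg_Iic, neg_zero]
    exact Iff.mpr integrableOn_Ici_iff_integrableOn_Ioi e1
  rw [← integrableOn_univ, ← Set.Iic_union_Ioi (a := (0:ℝ))]
  exact e2.union e1

lemma fp_int2 (h : ℝ) (h1 : h < 1) :
    Integrable (fun r : ℝ => (1 + |r|) ^ (-(3 / 2 - h / 2))) := by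
  have := integrable_one_add_norm (E := ℝ) (μ := volume) (r := 3 / 2 - h / 2)
    (by simp; linarith)
  simpa using this

lemma fp_int3 (h : ℝ) (h1 : h < 1) (b : ℝ) :
    Integrable (fun r : ℝ => (1 + |r - b|) ^ (-(3 / 2 - h / 2))) :=
  (fp_int2 h h1).comp_sub_right b

lemma fp_intb (h u b : ℝ) (h0 : 0 < h) (h1 : h < 1) :
    Integrable (fun r : ℝ => (|u| + 2) * (2 * (1 + |b|) ^ (-((1 - h) / 4)) *
        ((Set.Iic (1:ℝ)).indicator (fun y => y ^ (h - 1)) |r| +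
          ((1 + |r - b|) ^ (-(3 / 2 - h / 2)) + (1 + |r|) ^ (-(3 / 2 - h / 2)))))) :=
  (((fp_int1 h h0).add ((fp_int3 h h1 b).add (fp_int2 h h1))).const_mul _).const_mul _

lemma fp_int (h u b : ℝ) (h0 : 0 < h) (h1 : h < 1) :
    Integrable (fun r : ℝ =>
      ‖Complex.exp (Complex.I * ((u * (r - b) : ℝ) : ℂ)) - 1‖ / (|r - b| * |r| ^ (1 - h))) := by
  refine (fp_intb h u b h0 h1).mono' (Measurable.aestronglyMeasurable (by fun_prop)) ?_
  refine Eventually.of_forall fun r => ?_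
  rw [Real.norm_of_nonneg (by positivity)]
  exact fp_bound h u r b h0 h1

lemma fp_le (h u b : ℝ) (h0 : 0 < h) (h1 : h < 1) :
    ∫ r : ℝ,
      ‖Complex.exp (Complex.I * ((u * (r - b) : ℝ) : ℂ)) - 1‖ / (|r - b| * |r| ^ (1 - h)) ≤
    (|u| + 2) * (2 * (1 + |b|) ^ (-((1 - h) / 4)) *
        ((∫ r : ℝ, (Set.Iic (1:ℝ)).indicator (fun y => y ^ (h - 1)) |r|) +
          ((∫ r : ℝ, (1 + |r|) ^ (-(3 / 2 - h / 2))) +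
            ∫ r : ℝ, (1 + |r|) ^ (-(3 / 2 - h / 2))))) := by
  refine (integral_mono (fp_int h u b h0 h1) (fp_intb h u b h0 h1)
    fun r => fp_bound h u r b h0 h1).trans_eq ?_
  have hs : Integrable (fun r : ℝ =>
      (1 + |r - b|) ^ (-(3 / 2 - h / 2)) + (1 + |r|) ^ (-(3 / 2 - h / 2))) :=
    (fp_int3 h h1 b).add (fp_int2 h h1)
  rw [integral_const_mul, integral_const_mul,
    integral_add (fp_int1 h h0) hs,
    integral_add (fp_int3 h h1 b) (fp_int2 h h1),
    integral_sub_right_eq_self (fun r : ℝ => (1 + |r|) ^ (-(3 / 2 - h / 2))) b]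

/-- Lemma 7.1 ("fastphase"): for `𝔥 ∈ (0,1)`, `s > 0`, `a ≠ 0`, `u ≠ 0`, the integral
`I(ε) = ∫_ℝ |exp(i u (r − a/ε^s)) − 1| / (|r − a/ε^s| |r|^{1−𝔥}) dr` is finite for every
`ε ∈ (0,1)` and tends to `0` as `ε → 0⁺`. -/
theorem fastphase (𝔥 s a u : ℝ) (h𝔥 : 𝔥 ∈ Set.Ioo (0:ℝ) 1) (hs : 0 < s)
    (ha : a ≠ 0) (hu : u ≠ 0) :
    (∀ ε ∈ Set.Ioo (0:ℝ) 1,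
      Integrable (fun r : ℝ =>
        ‖Complex.exp (Complex.I * ((u * (r - a / ε ^ s) : ℝ) : ℂ)) - 1‖
          / (|r - a / ε ^ s| * |r| ^ (1 - 𝔥)))) ∧
    Tendsto (fun ε : ℝ =>
        ∫ r : ℝ, ‖Complex.exp (Complex.I * ((u * (r - a / ε ^ s) : ℝ) : ℂ)) - 1‖
          / (|r - a / ε ^ s| * |r| ^ (1 - 𝔥)))
      (nhdsWithin 0 (Set.Ioi 0)) (nhds 0) := by
  obtain ⟨h0, h1⟩ := h𝔥
  refine ⟨fun ε _ => fp_int 𝔥 u _ h0 h1, ?_⟩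
  have t1 : Tendsto (fun ε : ℝ => ε ^ s) (nhdsWithin 0 (Set.Ioi 0)) (nhdsWithin 0 (Set.Ioi 0)) := by
    refine tendsto_nhdsWithin_iff.2 ⟨?_, ?_⟩
    · have := (Real.continuousAt_rpow_const 0 s (Or.inr hs.le)).tendsto
      rw [Real.zero_rpow hs.ne'] at this
      exact this.mono_left nhdsWithin_le_nhds
    · filter_upwards [self_mem_nhdsWithin] with ε hε
      exact Real.rpow_pos_of_pos hε s
  have t2 : Tendsto (fun ε : ℝ => 1 + |a / ε ^ s|) (nhdsWithin 0 (Set.Ioi 0)) atTop := by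
    refine tendsto_atTop_add_const_left _ _ ?_
    have := (tendsto_inv_nhdsGT_zero.comp t1).const_mul_atTop (abs_pos.2 ha)
    refine this.congr' ?_
    filter_upwards [self_mem_nhdsWithin] with ε hε
    have : 0 < ε ^ s := Real.rpow_pos_of_pos hε s
    simp only [Function.comp]
    rw [abs_div, abs_of_pos this, div_eq_mul_inv]
  have t3 := (tendsto_rpow_neg_atTop (by linarith : 0 < (1 - 𝔥) / 4)).comp t2
  refine squeeze_zero (fun ε => integral_nonneg fun r => by positivity)
    (fun ε => fp_le 𝔥 u (a / ε ^ s) h0 h1) ?_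
  have t4 := ((t3.const_mul 2).mul_const
    ((∫ r : ℝ, (Set.Iic (1:ℝ)).indicator (fun y => y ^ (𝔥 - 1)) |r|) +
          ((∫ r : ℝ, (1 + |r|) ^ (-(3 / 2 - 𝔥 / 2))) +
            ∫ r : ℝ, (1 + |r|) ^ (-(3 / 2 - 𝔥 / 2))))).const_mul (|u| + 2)
  simpa only [mul_zero, zero_mul, Function.comp] using t4
end

section
/- For all real x ≥ 0 and α > 0, ( Re((x + iα)^{1/2}) − √x )² ≤ (1/2)(√(x² + α²) − x) ≤ α/2. -/
/-- Estimate (6.3): for `x ≥ 0` and `α > 0`,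
`(Re((x+iα)^{1/2}) − √x)² ≤ (1/2)(√(x²+α²) − x) ≤ α/2`. -/
theorem sqrt_absorption_estimate (x α : ℝ) (hx : 0 ≤ x) (hα : 0 < α) :
    ((((x : ℂ) + (α : ℂ) * Complex.I) ^ ((1 : ℂ) / 2)).re - Real.sqrt x) ^ 2
        ≤ (1 / 2) * (Real.sqrt (x ^ 2 + α ^ 2) - x) ∧
      (1 / 2) * (Real.sqrt (x ^ 2 + α ^ 2) - x) ≤ α / 2 := by
  have hR1 : x ≤ Real.sqrt (x ^ 2 + α ^ 2) := Real.le_sqrt_of_sq_le (by nlinarith)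
  have hR2 : Real.sqrt (x ^ 2 + α ^ 2) ≤ x + α :=
    Real.sqrt_le_iff.mpr ⟨by linarith, by nlinarith [mul_nonneg hx hα.le]⟩
  refine ⟨?_, by linarith⟩
  have h12 : ((1 : ℂ) / 2) = 2⁻¹ := by norm_num
  rw [h12, Complex.cpow_inv_two_re, Complex.norm_add_mul_I]
  have hre : ((x : ℂ) + (α : ℂ) * Complex.I).re = x := by simp
  rw [hre]
  generalize Real.sqrt (x ^ 2 + α ^ 2) = R at *
  have ha := Real.sq_sqrt (show 0 ≤ (R + x) / 2 by linarith)
  have hs := Real.sq_sqrt hx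
  have hle : Real.sqrt x ≤ Real.sqrt ((R + x) / 2) := Real.sqrt_le_sqrt (by linarith)
  have h0 := Real.sqrt_nonneg x
  nlinarith [mul_nonneg h0 (sub_nonneg.mpr hle)]
end

section
/- Let c₀ > 0, ω_c > 0, and let f : ℝ × ℝ² → ℂ be a bounded measurable function vanishing outside a compact set K ⊂ ℝ × ℝ² such that |ω| ≥ ω_c for every (ω,κ) ∈ K. Write k_ω := ω/c₀. Then there exists ε₀ > 0 such that ε²|κ|²/k_ω² < 1 for all (ω,κ) ∈ K and all ε ∈ (0,ε₀), and for every fixed (t,x) ∈ ℝ × ℝ² and every z₀ ∈ ℝ, lim_{ε→0⁺} ∬ e^{−iωt} e^{−iκ·x} exp( i k_ω (√(1 − ε²|κ|²/k_ω²) − 1) z₀/ε² ) f(ω,κ) dω dκ = ∬ e^{−iωt} e^{−iκ·x} exp( −i |κ|² z₀/(2k_ω) ) f(ω,κ) dω dκ. -/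
open MeasureTheory Filter

lemma phase_tendsto (k n z : ℝ) :
    Tendsto (fun ε : ℝ => k * (Real.sqrt (1 - ε ^ 2 * n ^ 2 / k ^ 2) - 1) * z / ε ^ 2)
      (nhdsWithin 0 (Set.Ioi 0)) (nhds (-(n ^ 2 * z / (2 * k)))) := by
  by_cases hk : k = 0
  · subst hk
    simp
  have hc : ContinuousAt (fun ε : ℝ =>
      -(n ^ 2 * z / ((Real.sqrt (1 - ε ^ 2 * n ^ 2 / k ^ 2) + 1) * k))) 0 := by
    have h1 : (Real.sqrt (1 - (0:ℝ) ^ 2 * n ^ 2 / k ^ 2) + 1) * k ≠ 0 := by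
      simp [hk]
    have h2 : Continuous (fun ε : ℝ => (Real.sqrt (1 - ε ^ 2 * n ^ 2 / k ^ 2) + 1) * k) := by
      fun_prop
    exact (continuousAt_const.div h2.continuousAt h1).neg
  have h0 := hc.tendsto.mono_left (nhdsWithin_le_nhds (s := Set.Ioi 0))
  have hval : -(n ^ 2 * z / ((Real.sqrt (1 - (0:ℝ) ^ 2 * n ^ 2 / k ^ 2) + 1) * k))
      = -(n ^ 2 * z / (2 * k)) := by
    norm_num
  rw [hval] at h0
  refine h0.congr' ?_
  have hpos : ∀ᶠ ε in nhdsWithin (0:ℝ) (Set.Ioi 0), 0 < 1 - ε ^ 2 * n ^ 2 / k ^ 2 := by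
    have h3 : Continuous (fun ε : ℝ => 1 - ε ^ 2 * n ^ 2 / k ^ 2) := by fun_prop
    exact nhdsWithin_le_nhds (h3.continuousAt.eventually (lt_mem_nhds (by simp)))
  filter_upwards [hpos, self_mem_nhdsWithin] with ε h1 h2
  have hε : ε ≠ 0 := ne_of_gt h2
  have hs := Real.sq_sqrt h1.le
  have hs0 := Real.sqrt_nonneg (1 - ε ^ 2 * n ^ 2 / k ^ 2)
  set r := Real.sqrt (1 - ε ^ 2 * n ^ 2 / k ^ 2)
  have hr : r + 1 ≠ 0 := by positivity
  have hs2 : k ^ 2 * r ^ 2 = k ^ 2 - ε ^ 2 * n ^ 2 := by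
    rw [hs]
    field_simp
  field_simp
  linear_combination (-z) * hs2

lemma norm_exp_I (a : ℝ) : ‖Complex.exp (Complex.I * (a : ℂ))‖ = 1 := by
  rw [mul_comm]
  exact Complex.norm_exp_ofReal_mul_I a

lemma norm_exp_neg_I (a : ℝ) : ‖Complex.exp (-Complex.I * (a : ℂ))‖ = 1 := by
  have := norm_exp_I (-a)
  simpa using this

/-- The paraxial approximation in a homogeneous medium: for a bounded measurable
amplitude `f(ω,κ)` supported in a compact set `K` with `|ω| ≥ ω_c` on `K`, writing
`k_ω = ω/c₀`, there is `ε₀ > 0` with `ε²|κ|²/k_ω² < 1` on `K` for `ε ∈ (0,ε₀)`, and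
for every `(t,x)` and `z₀` the oscillatory integral with phase
`k_ω(√(1−ε²|κ|²/k_ω²)−1)z₀/ε²` converges as `ε → 0⁺` to the one with the Schrödinger
phase `−|κ|²z₀/(2k_ω)`. -/
theorem paraxial_homogeneous (c₀ ωc : ℝ) (hc₀ : 0 < c₀) (hωc : 0 < ωc)
    (f : ℝ × EuclideanSpace ℝ (Fin 2) → ℂ)
    (K : Set (ℝ × EuclideanSpace ℝ (Fin 2))) (hK : IsCompact K)
    (hfm : Measurable f) (hfb : ∃ C, ∀ p, ‖f p‖ ≤ C)
    (hsupp : ∀ p ∉ K, f p = 0)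
    (hω : ∀ p ∈ K, ωc ≤ |p.1|) :
    ∃ ε₀ > (0:ℝ),
      (∀ p ∈ K, ∀ ε ∈ Set.Ioo (0:ℝ) ε₀, ε ^ 2 * ‖p.2‖ ^ 2 / (p.1 / c₀) ^ 2 < 1) ∧
      ∀ (t : ℝ) (x : EuclideanSpace ℝ (Fin 2)) (z₀ : ℝ),
        Tendsto (fun ε : ℝ =>
            ∫ p : ℝ × EuclideanSpace ℝ (Fin 2),
              Complex.exp (-Complex.I * ((p.1 * t : ℝ) : ℂ)) *
                Complex.exp (-Complex.I * ((inner ℝ p.2 x : ℝ) : ℂ)) *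
                Complex.exp (Complex.I *
                  (((p.1 / c₀) * (Real.sqrt (1 - ε ^ 2 * ‖p.2‖ ^ 2 / (p.1 / c₀) ^ 2) - 1)
                    * z₀ / ε ^ 2 : ℝ) : ℂ)) * f p)
          (nhdsWithin 0 (Set.Ioi 0))
          (nhds (∫ p : ℝ × EuclideanSpace ℝ (Fin 2),
              Complex.exp (-Complex.I * ((p.1 * t : ℝ) : ℂ)) *
                Complex.exp (-Complex.I * ((inner ℝ p.2 x : ℝ) : ℂ)) *
                Complex.exp (-Complex.I *
                  ((‖p.2‖ ^ 2 * z₀ / (2 * (p.1 / c₀)) : ℝ) : ℂ)) * f p)) := by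
  obtain ⟨C, hC⟩ := hfb
  obtain ⟨M, hM0, hM⟩ := hK.isBounded.exists_pos_norm_le
  refine ⟨ωc / (c₀ * M), by positivity, ?_, ?_⟩
  · rintro p hp ε ⟨h0, h1⟩
    have hp2 : ‖p.2‖ ≤ M := (norm_snd_le p).trans (hM p hp)
    have hw := hω p hp
    rw [lt_div_iff₀ (by positivity)] at h1
    have h3 : ε * c₀ * ‖p.2‖ < |p.1| := by
      have : ε * c₀ * ‖p.2‖ ≤ ε * c₀ * M := by gcongr
      nlinarith
    have h4 : (ε * c₀ * ‖p.2‖) ^ 2 < p.1 ^ 2 := by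
      rw [← sq_abs p.1]
      gcongr
    have h5 : 0 < p.1 ^ 2 := lt_of_le_of_lt (sq_nonneg _) h4
    have h6 : 0 < (p.1 / c₀) ^ 2 := by
      rw [div_pow]
      positivity
    rw [div_lt_one h6, div_pow, lt_div_iff₀ (by positivity)]
    nlinarith
  · intro t x z₀
    have hfi : Integrable f := by
      have h1 : IntegrableOn f K := by
        refine Measure.integrableOn_of_bounded (M := C) hK.measure_lt_top.ne
          hfm.aestronglyMeasurable ?_
        exact Eventually.of_forall hC
      refine (integrableOn_iff_integrable_of_support_subset ?_).1 h1
      intro p hp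
      by_contra h
      exact hp (hsupp p h)
    refine tendsto_integral_filter_of_dominated_convergence (fun p => ‖f p‖) ?_ ?_ hfi.norm ?_
    · refine Eventually.of_forall fun ε => Measurable.aestronglyMeasurable ?_
      fun_prop
    · refine Eventually.of_forall fun ε => Eventually.of_forall fun p => ?_
      rw [norm_mul, norm_mul, norm_mul, norm_exp_neg_I, norm_exp_neg_I, norm_exp_I]
      simp
    · refine Eventually.of_forall fun p => ?_
      have h := phase_tendsto (p.1 / c₀) ‖p.2‖ z₀
      have h2 := (Complex.continuous_ofReal.tendsto _).comp h
      have h3 := (Complex.continuous_exp.tendsto _).comp (h2.const_mul Complex.I)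
      have e : Complex.exp (-Complex.I * ((‖p.2‖ ^ 2 * z₀ / (2 * (p.1 / c₀)) : ℝ) : ℂ))
          = Complex.exp (Complex.I * ((-(‖p.2‖ ^ 2 * z₀ / (2 * (p.1 / c₀))) : ℝ) : ℂ)) := by
        rw [Complex.ofReal_neg, mul_neg, neg_mul]
      rw [e]
      exact (h3.const_mul _).mul_const _
end

section
/- Let 𝔥 ∈ (0,1), c > 0, and let r : (0,∞) → [−1,1] be measurable with lim_{z→∞} z^𝔥 r(z) = c. Let X and Z be independent standard Gaussian random variables, and let Θ : ℝ → ℝ be measurable with ∫ Θ(u)² γ(du) < ∞ and ∫ Θ(u) γ(du) = 0 (for instance Θ odd). Then lim_{z→∞} z^𝔥 · E[ Θ(X) · Θ( r(z) X + √(1 − r(z)²) Z ) ] = c · ( ∫ u Θ(u) γ(du) )². -/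
open MeasureTheory ProbabilityTheory Filter

noncomputable def mehlerK (ρ : ℝ) (p : ℝ × ℝ) : ℝ :=
  (Real.sqrt (1 - ρ ^ 2))⁻¹ *
    Real.exp (-(ρ ^ 2 * p.1 ^ 2 + ρ ^ 2 * p.2 ^ 2 - 2 * ρ * p.1 * p.2) / (2 * (1 - ρ ^ 2)))

lemma mehlerK_meas (ρ : ℝ) : Measurable (mehlerK ρ) := by
  unfold mehlerK; fun_prop

lemma mehlerK_nonneg (ρ : ℝ) (p : ℝ × ℝ) : 0 ≤ mehlerK ρ p := by
  unfold mehlerK; positivity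

lemma lint_gauss (f : ℝ → ENNReal) (hf : Measurable f) (m : ℝ) (v : NNReal) (hv : v ≠ 0) :
    ∫⁻ y, f y ∂(gaussianReal m v) = ∫⁻ y, ENNReal.ofReal (gaussianPDFReal m v y) * f y := by
  rw [gaussianReal_of_var_ne_zero m hv,
    lintegral_withDensity_eq_lintegral_mul _ (measurable_gaussianPDF m v) hf]
  rfl

lemma mehlerK_pdf (ρ : ℝ) (hρ : ρ ^ 2 < 1) (v : NNReal) (hv : (v : ℝ) = 1 - ρ ^ 2) (x y : ℝ) :
    gaussianPDFReal (ρ * x) v y = gaussianPDFReal 0 1 y * mehlerK ρ (x, y) := by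
  have h : 0 < 1 - ρ ^ 2 := by linarith
  unfold gaussianPDFReal mehlerK
  rw [hv, Real.sqrt_mul (by positivity)]
  simp only [NNReal.coe_one, mul_one, sub_zero]
  rw [mul_inv, mul_mul_mul_comm, ← Real.exp_add]
  congr 2
  field_simp
  ring

lemma map_eq (ρ : ℝ) (hρ : ρ ^ 2 < 1) :
    ((gaussianReal 0 1).prod (gaussianReal 0 1)).map
      (fun p : ℝ × ℝ => (p.1, ρ * p.1 + Real.sqrt (1 - ρ ^ 2) * p.2)) =
    ((gaussianReal 0 1).prod (gaussianReal 0 1)).withDensity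
      (fun p => ENNReal.ofReal (mehlerK ρ p)) := by
  have h : 0 < 1 - ρ ^ 2 := by linarith
  have hM := mehlerK_meas ρ
  refine Measure.ext_of_lintegral _ fun f hf => ?_
  rw [lintegral_map hf (by fun_prop), lintegral_prod _ (by fun_prop),
    lintegral_withDensity_eq_lintegral_mul _ (by fun_prop) hf, lintegral_prod _ (by fun_prop)]
  refine lintegral_congr fun x => ?_
  let v : NNReal := ⟨1 - ρ ^ 2, h.le⟩
  have hv : v ≠ 0 := by
    intro h0
    have : (v : ℝ) = 0 := by rw [h0]; rfl
    exact h.ne' this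
  have hmap : (gaussianReal 0 1).map (fun z => ρ * x + Real.sqrt (1 - ρ ^ 2) * z)
      = gaussianReal (ρ * x) v := by
    have : (fun z => ρ * x + Real.sqrt (1 - ρ ^ 2) * z) =
      (fun z => ρ * x + z) ∘ (fun z => Real.sqrt (1 - ρ ^ 2) * z) := rfl
    rw [this, ← Measure.map_map (by fun_prop) (by fun_prop), gaussianReal_map_const_mul,
      gaussianReal_map_const_add]
    congr 1
    · ring
    · ext
      simp [v, Real.sq_sqrt h.le]
      rfl
  have hfx : Measurable (fun y => f (x, y)) := by fun_prop
  calc ∫⁻ z, f (x, ρ * x + Real.sqrt (1 - ρ ^ 2) * z) ∂(gaussianReal 0 1)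
      = ∫⁻ y, f (x, y) ∂(gaussianReal (ρ * x) v) := by
        rw [← hmap, lintegral_map hfx (by fun_prop)]
    _ = _ := by
        rw [lint_gauss _ hfx _ _ hv, lint_gauss _ (by fun_prop) _ _ one_ne_zero]
        refine lintegral_congr fun y => ?_
        rw [mehlerK_pdf ρ hρ v rfl, ENNReal.ofReal_mul (gaussianPDFReal_nonneg _ _ _), mul_assoc]
        rfl

lemma int_map (ρ : ℝ) (hρ : ρ ^ 2 < 1) (f : ℝ × ℝ → ℝ) (hf : Measurable f) :
    ∫ p, f (p.1, ρ * p.1 + Real.sqrt (1 - ρ ^ 2) * p.2)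
      ∂((gaussianReal 0 1).prod (gaussianReal 0 1)) =
    ∫ p, mehlerK ρ p * f p ∂((gaussianReal 0 1).prod (gaussianReal 0 1)) := by
  have hM := mehlerK_meas ρ
  rw [← integral_map (φ := fun p : ℝ × ℝ => (p.1, ρ * p.1 + Real.sqrt (1 - ρ ^ 2) * p.2))
    (by fun_prop) hf.aestronglyMeasurable, map_eq ρ hρ,
    integral_withDensity_eq_integral_toReal_smul (by fun_prop) (by simp)]
  simp [ENNReal.toReal_ofReal (mehlerK_nonneg ρ _)]

lemma lint_exp (p q : ℝ) (hq : 2 * q < 1) :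
    ∫⁻ y, ENNReal.ofReal (Real.exp (p * y + q * y ^ 2)) ∂(gaussianReal 0 1) =
      ENNReal.ofReal ((Real.sqrt (1 - 2 * q))⁻¹ * Real.exp (p ^ 2 / (2 * (1 - 2 * q)))) := by
  have h : 0 < 1 - 2 * q := by linarith
  rw [lint_gauss _ (by fun_prop) _ _ one_ne_zero]
  let v : NNReal := ⟨(1 - 2 * q)⁻¹, by positivity⟩
  have hv0 : (v : ℝ) = (1 - 2 * q)⁻¹ := rfl
  have hv : v ≠ 0 := by
    intro h0
    have : (v : ℝ) = 0 := by rw [h0]; rfl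
    exact (inv_pos.2 h).ne' this
  have key : ∀ y, ENNReal.ofReal (gaussianPDFReal 0 1 y) *
      ENNReal.ofReal (Real.exp (p * y + q * y ^ 2)) =
      ENNReal.ofReal ((Real.sqrt (1 - 2 * q))⁻¹ * Real.exp (p ^ 2 / (2 * (1 - 2 * q)))) *
      ENNReal.ofReal (gaussianPDFReal (p * (1 - 2 * q)⁻¹) v y) := by
    intro y
    rw [← ENNReal.ofReal_mul (gaussianPDFReal_nonneg _ _ _), ← ENNReal.ofReal_mul (by positivity)]
    congr 1
    unfold gaussianPDFReal
    rw [hv0, Real.sqrt_mul (by positivity) (1 - 2 * q)⁻¹, Real.sqrt_inv, mul_inv _ (√(1 - 2 * q))⁻¹,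
      inv_inv]
    simp only [NNReal.coe_one, mul_one, sub_zero]
    rw [mul_assoc, ← Real.exp_add]
    have hs : Real.sqrt (1 - 2 * q) ≠ 0 := by positivity
    have : ∀ a e₁ e₂ s : ℝ, s ≠ 0 → s⁻¹ * e₁ * (a * s * e₂) = a * (e₁ * e₂) := by
      intro a e₁ e₂ s hs
      field_simp
    rw [this _ _ _ _ hs, ← Real.exp_add]
    congr 2
    field_simp
    ring
  simp_rw [key]
  rw [lintegral_const_mul _ (by fun_prop), lintegral_gaussianPDFReal_eq_one _ hv, mul_one]

lemma lint_sq (ρ : ℝ) (hρ : ρ ^ 2 < 1) :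
    ∫⁻ p, ENNReal.ofReal (mehlerK ρ p ^ 2) ∂((gaussianReal 0 1).prod (gaussianReal 0 1)) =
      ENNReal.ofReal (1 - ρ ^ 2)⁻¹ := by
  have h : 0 < 1 - ρ ^ 2 := by linarith
  have h' : 0 < 1 + ρ ^ 2 := by positivity
  have hM := mehlerK_meas ρ
  rw [lintegral_prod _ (by fun_prop)]
  have e1 : 1 - 2 * (-ρ ^ 2 / (1 - ρ ^ 2)) = (1 + ρ ^ 2) / (1 - ρ ^ 2) := by
    field_simp; ring
  have e2 : 1 - 2 * (ρ ^ 2 / (1 + ρ ^ 2)) = (1 - ρ ^ 2) / (1 + ρ ^ 2) := by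
    field_simp; ring
  have key : ∀ x, ∫⁻ y, ENNReal.ofReal (mehlerK ρ (x, y) ^ 2) ∂(gaussianReal 0 1) =
      ENNReal.ofReal ((1 - ρ ^ 2)⁻¹ * (Real.sqrt ((1 + ρ ^ 2) / (1 - ρ ^ 2)))⁻¹) *
      ENNReal.ofReal (Real.exp (0 * x + ρ ^ 2 / (1 + ρ ^ 2) * x ^ 2)) := by
    intro x
    have : ∀ y, ENNReal.ofReal (mehlerK ρ (x, y) ^ 2) =
        ENNReal.ofReal ((1 - ρ ^ 2)⁻¹ * Real.exp (-ρ ^ 2 * x ^ 2 / (1 - ρ ^ 2))) *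
        ENNReal.ofReal (Real.exp (2 * ρ * x / (1 - ρ ^ 2) * y
          + (-ρ ^ 2 / (1 - ρ ^ 2)) * y ^ 2)) := by
      intro y
      rw [← ENNReal.ofReal_mul (by positivity)]
      congr 1
      unfold mehlerK
      rw [mul_pow, inv_pow, Real.sq_sqrt h.le, ← Real.exp_nat_mul,
        mul_assoc (1 - ρ ^ 2)⁻¹, ← Real.exp_add]
      congr 2
      push_cast
      field_simp
      ring
    simp_rw [this]
    rw [lintegral_const_mul _ (by fun_prop), lint_exp _ _ (by linarith [e1, div_pos h' h]), e1,
      ← ENNReal.ofReal_mul (by positivity), ← ENNReal.ofReal_mul (by positivity)]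
    congr 1
    rw [mul_mul_mul_comm, ← Real.exp_add]
    congr 2
    field_simp
    ring
  simp_rw [key]
  rw [lintegral_const_mul _ (by fun_prop), lint_exp _ _ (by linarith [e2, div_pos h h']), e2,
    ← ENNReal.ofReal_mul (by positivity)]
  congr 1
  have hs : Real.sqrt ((1 + ρ ^ 2) / (1 - ρ ^ 2)) * Real.sqrt ((1 - ρ ^ 2) / (1 + ρ ^ 2)) = 1 := by
    rw [← Real.sqrt_mul (by positivity)]
    rw [div_mul_div_cancel₀ h.ne', div_self h'.ne', Real.sqrt_one]
  simp only [ne_eq, OfNat.ofNat_ne_zero, not_false_eq_true, zero_pow, zero_div, Real.exp_zero,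
    mul_one]
  rw [mul_assoc, ← mul_inv, hs, inv_one, mul_one]

lemma int_sq_gauss : ∫ x, x ^ 2 ∂(gaussianReal 0 1) = 1 := by
  have h := variance_fun_id_gaussianReal (μ := 0) (v := 1)
  rw [variance_eq_integral (by fun_prop)] at h
  simpa using h

lemma memLp_id2 : MemLp (fun x : ℝ => x) 2 (gaussianReal 0 1) := by
  exact_mod_cast memLp_id_gaussianReal (μ := 0) (v := 1) 2

lemma memLp_prod2 (f : ℝ → ℝ) (hf : Measurable f)
    (h : Integrable (fun x => f x ^ 2) (gaussianReal 0 1)) :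
    MemLp (fun p : ℝ × ℝ => f p.1 * f p.2) 2 ((gaussianReal 0 1).prod (gaussianReal 0 1)) := by
  rw [memLp_two_iff_integrable_sq (by fun_prop)]
  simp_rw [mul_pow]
  exact h.mul_prod h

lemma K_sq (ρ : ℝ) (hρ : ρ ^ 2 < 1) :
    MemLp (mehlerK ρ) 2 ((gaussianReal 0 1).prod (gaussianReal 0 1)) ∧
    Integrable (fun p : ℝ × ℝ => (mehlerK ρ p - 1 - ρ * (p.1 * p.2)) ^ 2)
      ((gaussianReal 0 1).prod (gaussianReal 0 1)) ∧
    ∫ p : ℝ × ℝ, (mehlerK ρ p - 1 - ρ * (p.1 * p.2)) ^ 2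
      ∂((gaussianReal 0 1).prod (gaussianReal 0 1)) = (1 - ρ ^ 2)⁻¹ - 1 - ρ ^ 2 := by
  have h : 0 < 1 - ρ ^ 2 := by linarith
  have hM := mehlerK_meas ρ
  set γ := (gaussianReal 0 1).prod (gaussianReal 0 1) with hγ
  have i1 : Integrable (fun p => mehlerK ρ p ^ 2) γ := by
    refine ⟨by fun_prop, ?_⟩
    rw [hasFiniteIntegral_iff_ofReal (by filter_upwards with p; positivity), lint_sq ρ hρ]
    exact ENNReal.ofReal_lt_top
  have v1 : ∫ p, mehlerK ρ p ^ 2 ∂γ = (1 - ρ ^ 2)⁻¹ := by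
    rw [integral_eq_lintegral_of_nonneg_ae (by filter_upwards with p; positivity) (by fun_prop),
      lint_sq ρ hρ, ENNReal.toReal_ofReal (by positivity)]
  have m1 : MemLp (mehlerK ρ) 2 γ := (memLp_two_iff_integrable_sq (by fun_prop)).2 i1
  have m2 : MemLp (fun p : ℝ × ℝ => p.1 * p.2) 2 γ :=
    memLp_prod2 (fun x => x) measurable_id memLp_id2.integrable_sq
  have i2 : Integrable (mehlerK ρ) γ := m1.integrable (by norm_num)
  have i3 : Integrable (fun p : ℝ × ℝ => p.1 * p.2) γ := m2.integrable (by norm_num)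
  have i4 : Integrable (fun p : ℝ × ℝ => (p.1 * p.2) ^ 2) γ := m2.integrable_sq
  have i5 : Integrable (fun p : ℝ × ℝ => mehlerK ρ p * (p.1 * p.2)) γ := m1.integrable_mul m2
  have v2 : ∫ p, mehlerK ρ p ∂γ = 1 := by
    have := int_map ρ hρ (fun _ => 1) measurable_const
    simpa using this.symm
  have v3 : ∫ p : ℝ × ℝ, p.1 * p.2 ∂γ = 0 := by
    rw [hγ, integral_prod_mul (fun x : ℝ => x) (fun x : ℝ => x)]
    simp
  have v4 : ∫ p : ℝ × ℝ, (p.1 * p.2) ^ 2 ∂γ = 1 := by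
    simp_rw [mul_pow]
    rw [hγ, integral_prod_mul (fun x : ℝ => x ^ 2) (fun x : ℝ => x ^ 2), int_sq_gauss, one_mul]
  have i6 : Integrable (fun p : ℝ × ℝ => p.1 ^ 2) γ := by
    simpa using memLp_id2.integrable_sq.mul_prod
      (integrable_const (μ := gaussianReal 0 1) (1 : ℝ))
  have v6 : ∫ p : ℝ × ℝ, p.1 ^ 2 ∂γ = 1 := by
    have := integral_prod_mul (μ := gaussianReal 0 1) (ν := gaussianReal 0 1)
      (fun x : ℝ => x ^ 2) (fun x : ℝ => (1 : ℝ))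
    simpa [int_sq_gauss] using this
  have v5 : ∫ p : ℝ × ℝ, mehlerK ρ p * (p.1 * p.2) ∂γ = ρ := by
    rw [← int_map ρ hρ (fun p => p.1 * p.2) (by fun_prop)]
    have : ∀ p : ℝ × ℝ, p.1 * (ρ * p.1 + Real.sqrt (1 - ρ ^ 2) * p.2) =
      ρ * p.1 ^ 2 + Real.sqrt (1 - ρ ^ 2) * (p.1 * p.2) := fun p => by ring
    simp_rw [this]
    rw [integral_add (i6.const_mul _) (i3.const_mul _), integral_const_mul, integral_const_mul,
      v3, v6]
    ring
  have e : ∀ p : ℝ × ℝ, (mehlerK ρ p - 1 - ρ * (p.1 * p.2)) ^ 2 =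
      ((((mehlerK ρ p ^ 2 + 1) + ρ ^ 2 * (p.1 * p.2) ^ 2) + (-2) * mehlerK ρ p) +
      (-2 * ρ) * (mehlerK ρ p * (p.1 * p.2))) + (2 * ρ) * (p.1 * p.2) := fun p => by ring
  have j1 := i1.fun_add (integrable_const (μ := γ) (1 : ℝ))
  have j2 := j1.fun_add (i4.const_mul (ρ ^ 2))
  have j3 := j2.fun_add (i2.const_mul (-2))
  have j4 := j3.fun_add (i5.const_mul (-2 * ρ))
  have j5 := j4.fun_add (i3.const_mul (2 * ρ))
  refine ⟨m1, ?_, ?_⟩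
  · simp_rw [e]; exact j5
  · simp_rw [e]
    rw [integral_add j4 (i3.const_mul (2 * ρ)), integral_add j3 (i5.const_mul (-2 * ρ)),
      integral_add j2 (i2.const_mul (-2)), integral_add j1 (i4.const_mul (ρ ^ 2)),
      integral_add i1 (integrable_const (μ := γ) (1 : ℝ))]
    simp only [integral_const_mul, v1, v2, v3, v4, v5, integral_const, probReal_univ, smul_eq_mul]
    ring

lemma F_bound (ρ : ℝ) (hρ : ρ ^ 2 ≤ 1 / 4) (hρ0 : ρ ≠ 0) (Θ : ℝ → ℝ) (hΘm : Measurable Θ)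
    (hΘ2 : Integrable (fun u => (Θ u) ^ 2) (gaussianReal 0 1))
    (hΘ0 : ∫ u, Θ u ∂(gaussianReal 0 1) = 0) :
    |(∫ p : ℝ × ℝ, Θ p.1 * Θ (ρ * p.1 + Real.sqrt (1 - ρ ^ 2) * p.2)
      ∂((gaussianReal 0 1).prod (gaussianReal 0 1))) -
        ρ * (∫ u, u * Θ u ∂(gaussianReal 0 1)) ^ 2| ≤
      ρ ^ 2 * ((∫ u, (Θ u) ^ 2 ∂(gaussianReal 0 1)) ^ 2 + 2) := by
  have hρ1 : ρ ^ 2 < 1 := by linarith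
  have hρp : 0 < ρ ^ 2 := by positivity
  obtain ⟨m1, iK, vK⟩ := K_sq ρ hρ1
  rw [int_map ρ hρ1 (fun p => Θ p.1 * Θ p.2) (by fun_prop)]
  have mg := memLp_prod2 Θ hΘm hΘ2
  have m2 := memLp_prod2 (fun x => x) measurable_id memLp_id2.integrable_sq
  set γ := (gaussianReal 0 1).prod (gaussianReal 0 1) with hγ
  have i1 : Integrable (fun p : ℝ × ℝ => mehlerK ρ p * (Θ p.1 * Θ p.2)) γ := m1.integrable_mul mg
  have i2 : Integrable (fun p : ℝ × ℝ => (p.1 * p.2) * (Θ p.1 * Θ p.2)) γ := m2.integrable_mul mg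
  have i3 : Integrable (fun p : ℝ × ℝ => Θ p.1 * Θ p.2) γ := mg.integrable (by norm_num)
  have v3 : ∫ p : ℝ × ℝ, Θ p.1 * Θ p.2 ∂γ = 0 := by
    rw [hγ, integral_prod_mul Θ Θ, hΘ0, zero_mul]
  have v2 : ∫ p : ℝ × ℝ, (p.1 * p.2) * (Θ p.1 * Θ p.2) ∂γ =
      (∫ u, u * Θ u ∂(gaussianReal 0 1)) ^ 2 := by
    have : ∀ p : ℝ × ℝ, (p.1 * p.2) * (Θ p.1 * Θ p.2) = (p.1 * Θ p.1) * (p.2 * Θ p.2) :=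
      fun p => by ring
    simp_rw [this]
    rw [hγ, integral_prod_mul (fun u => u * Θ u) (fun u => u * Θ u), sq]
  have vg : ∫ p : ℝ × ℝ, (Θ p.1 * Θ p.2) ^ 2 ∂γ = (∫ u, (Θ u) ^ 2 ∂(gaussianReal 0 1)) ^ 2 := by
    simp_rw [mul_pow]
    rw [hγ, integral_prod_mul (fun u => Θ u ^ 2) (fun u => Θ u ^ 2), sq]
  have e : (∫ p : ℝ × ℝ, mehlerK ρ p * (Θ p.1 * Θ p.2) ∂γ) -
      ρ * (∫ u, u * Θ u ∂(gaussianReal 0 1)) ^ 2 =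
      ∫ p : ℝ × ℝ, (mehlerK ρ p - 1 - ρ * (p.1 * p.2)) * (Θ p.1 * Θ p.2) ∂γ := by
    have : ∀ p : ℝ × ℝ, (mehlerK ρ p - 1 - ρ * (p.1 * p.2)) * (Θ p.1 * Θ p.2) =
      mehlerK ρ p * (Θ p.1 * Θ p.2) - Θ p.1 * Θ p.2 -
        ρ * ((p.1 * p.2) * (Θ p.1 * Θ p.2)) := fun p => by ring
    simp_rw [this]
    have i13 : Integrable (fun p : ℝ × ℝ => mehlerK ρ p * (Θ p.1 * Θ p.2) - Θ p.1 * Θ p.2) γ :=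
      i1.sub i3
    rw [integral_sub i13 (i2.const_mul ρ), integral_sub i1 i3, integral_const_mul, v2, v3]
    ring
  rw [e, ← Real.norm_eq_abs]
  have ib : Integrable (fun p : ℝ × ℝ => ρ ^ 2 * (Θ p.1 * Θ p.2) ^ 2 +
      (ρ ^ 2)⁻¹ * (mehlerK ρ p - 1 - ρ * (p.1 * p.2)) ^ 2) γ :=
    (mg.integrable_sq.const_mul _).add (iK.const_mul _)
  refine (norm_integral_le_of_norm_le ib ?_).trans ?_
  · filter_upwards with p
    rw [Real.norm_eq_abs]
    generalize mehlerK ρ p - 1 - ρ * (p.1 * p.2) = k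
    generalize Θ p.1 * Θ p.2 = g
    have hk : (ρ ^ 2)⁻¹ * k ^ 2 = (k / ρ) ^ 2 := by field_simp
    have hkg : k * g = (k / ρ) * (ρ * g) := by field_simp
    rw [hk, hkg, abs_le]
    generalize k / ρ = t
    constructor
    · nlinarith [sq_nonneg (t + ρ * g), sq_nonneg t, sq_nonneg (ρ * g)]
    · nlinarith [sq_nonneg (t - ρ * g), sq_nonneg t, sq_nonneg (ρ * g)]
  · rw [integral_add (mg.integrable_sq.const_mul _) (iK.const_mul _), integral_const_mul,
      integral_const_mul, vg, vK, mul_add]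
    have h : 0 < 1 - ρ ^ 2 := by linarith
    have : (ρ ^ 2)⁻¹ * ((1 - ρ ^ 2)⁻¹ - 1 - ρ ^ 2) = ρ ^ 2 * (1 - ρ ^ 2)⁻¹ := by
      field_simp
      ring
    rw [this]
    have : (1 - ρ ^ 2)⁻¹ ≤ 2 := by
      rw [inv_le_comm₀ h (by norm_num)]
      linarith
    gcongr



/-- Scalar core of Proposition 5.1 (long-range property of `V`): if `(X,Z)` are
independent standard Gaussians, `Θ` is square integrable and centered for the
standard Gaussian measure `γ`, and `r(z) ∈ [−1,1]` satisfies `z^𝔥 r(z) → c`, then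
`z^𝔥 E[Θ(X)Θ(r(z)X + √(1−r(z)²)Z)] → c (∫ u Θ(u) γ(du))²`. -/
theorem long_range_covariance (𝔥 c : ℝ) (h𝔥 : 𝔥 ∈ Set.Ioo (0:ℝ) 1) (hc : 0 < c)
    (r : ℝ → ℝ) (hrm : Measurable r) (hrb : ∀ z > 0, |r z| ≤ 1)
    (hr : Tendsto (fun z : ℝ => z ^ 𝔥 * r z) atTop (nhds c))
    {Ω : Type*} [MeasurableSpace Ω] (μ : Measure Ω) [IsProbabilityMeasure μ]
    (X Z : Ω → ℝ)
    (hX : μ.map X = gaussianReal 0 1) (hZ : μ.map Z = gaussianReal 0 1)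
    (hXZ : IndepFun X Z μ)
    (Θ : ℝ → ℝ) (hΘm : Measurable Θ)
    (hΘ2 : Integrable (fun u => (Θ u) ^ 2) (gaussianReal 0 1))
    (hΘ0 : ∫ u, Θ u ∂(gaussianReal 0 1) = 0) :
    Tendsto (fun z : ℝ => z ^ 𝔥 *
        ∫ ω, Θ (X ω) * Θ (r z * X ω + Real.sqrt (1 - (r z) ^ 2) * Z ω) ∂μ)
      atTop (nhds (c * (∫ u, u * Θ u ∂(gaussianReal 0 1)) ^ 2)) := by
  have hγX : AEMeasurable X μ := AEMeasurable.of_map_ne_zero (by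
    rw [hX]; exact IsProbabilityMeasure.ne_zero _)
  have hγZ : AEMeasurable Z μ := AEMeasurable.of_map_ne_zero (by
    rw [hZ]; exact IsProbabilityMeasure.ne_zero _)
  have hmap := (indepFun_iff_map_prod_eq_prod_map_map hγX hγZ).1 hXZ
  rw [hX, hZ] at hmap
  have hE : ∀ z, ∫ ω, Θ (X ω) * Θ (r z * X ω + Real.sqrt (1 - (r z) ^ 2) * Z ω) ∂μ =
      ∫ p : ℝ × ℝ, Θ p.1 * Θ (r z * p.1 + Real.sqrt (1 - (r z) ^ 2) * p.2)
      ∂((gaussianReal 0 1).prod (gaussianReal 0 1)) := by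
    intro z
    rw [← hmap, integral_map (hγX.prodMk hγZ)
      (Measurable.aestronglyMeasurable (by fun_prop))]
  simp_rw [hE]
  set a := ∫ u, u * Θ u ∂(gaussianReal 0 1)
  set C := (∫ u, (Θ u) ^ 2 ∂(gaussianReal 0 1)) ^ 2 + 2
  have hr0 : Tendsto r atTop (nhds 0) := by
    have h1 := (tendsto_rpow_neg_atTop h𝔥.1).mul hr
    rw [zero_mul] at h1
    refine h1.congr' ?_
    filter_upwards [eventually_gt_atTop 0] with z hz
    rw [← mul_assoc, ← Real.rpow_add hz]
    simp
  have hsmall : ∀ᶠ z in atTop, (r z) ^ 2 ≤ 1 / 4 := by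
    have : Tendsto (fun z => (r z) ^ 2) atTop (nhds 0) := by simpa using hr0.pow 2
    exact this.eventually_le_const (by norm_num)
  have hne : ∀ᶠ z in atTop, r z ≠ 0 := by
    filter_upwards [hr.eventually_const_lt hc] with z hz h0
    simp [h0] at hz
  have hlim : Tendsto (fun z : ℝ => (z ^ 𝔥 * r z) * r z * C) atTop (nhds 0) := by
    simpa using (hr.mul hr0).mul_const C
  have hmain : Tendsto (fun z : ℝ => z ^ 𝔥 *
      (∫ p : ℝ × ℝ, Θ p.1 * Θ (r z * p.1 + Real.sqrt (1 - (r z) ^ 2) * p.2)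
      ∂((gaussianReal 0 1).prod (gaussianReal 0 1))) - (z ^ 𝔥 * r z) * a ^ 2) atTop (nhds 0) := by
    refine squeeze_zero_norm' ?_ hlim
    filter_upwards [hsmall, hne, eventually_gt_atTop 0] with z h1 h2 hz
    have := F_bound (r z) h1 h2 Θ hΘm hΘ2 hΘ0
    rw [mul_assoc, ← mul_sub, norm_mul, Real.norm_eq_abs, Real.norm_eq_abs,
      abs_of_nonneg (Real.rpow_nonneg hz.le _)]
    calc _ ≤ z ^ 𝔥 * ((r z) ^ 2 * C) :=
          mul_le_mul_of_nonneg_left this (Real.rpow_nonneg hz.le _)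
      _ = _ := by ring
  have := hmain.add (hr.mul_const (a ^ 2))
  simpa using this
end

section
/- Let 𝔥 ∈ (0,1), c > 0 and z > 0, and let r : [0,∞) → ℝ be measurable with |r(u)| ≤ 1 for all u ≥ 0 and lim_{u→∞} u^𝔥 r(u) = c; extend r to ℝ by setting r(−u) = r(u). Then lim_{ε→0⁺} ε^{−𝔥} ∫₀^z ∫₀^z | r((u−v)/ε) − ε^𝔥 c |u−v|^{−𝔥} | du dv = 0. -/
open MeasureTheory Filter

lemma aux_integrable (h z : ℝ) (h1 : h < 1) (hz : 0 < z) :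
    IntegrableOn (fun x : ℝ => |x| ^ (-h)) (Set.Icc (-z) z) := by
  have hp : IntervalIntegrable (fun x : ℝ => |x| ^ (-h)) volume 0 z := by
    refine (intervalIntegral.intervalIntegrable_rpow' (a := 0) (b := z) (r := -h)
      (by linarith)).congr ?_
    intro x hx
    rw [Set.uIoc_of_le hz.le] at hx
    simp [abs_of_pos hx.1]
  have hn : IntervalIntegrable (fun x : ℝ => |x| ^ (-h)) volume (-z) 0 := by
    have := ((IntervalIntegrable.iff_comp_neg (by simp)).mp hp).symm
    simpa using this
  have := hn.trans hp
  rwa [intervalIntegrable_iff_integrableOn_Icc_of_le (by linarith)] at this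

lemma aux_bdd (h c : ℝ) (h0 : 0 < h) (hc : 0 < c) (r : ℝ → ℝ)
    (hr1 : ∀ u ≥ (0:ℝ), |r u| ≤ 1)
    (hrlim : Tendsto (fun u : ℝ => u ^ h * r u) atTop (nhds c)) :
    ∃ M, ∀ s ≥ 0, |s ^ h * r s - c| ≤ M := by
  have h1 := (hrlim.sub_const c).abs
  rw [sub_self, abs_zero] at h1
  obtain ⟨A, hA⟩ := eventually_atTop.mp (h1.eventually (ge_mem_nhds (zero_lt_one)))
  refine ⟨max 1 (|A| ^ h + c), fun s hs => ?_⟩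
  by_cases hsA : A ≤ s
  · exact le_max_of_le_left (hA s hsA)
  · apply le_max_of_le_right
    push Not at hsA
    have e1 : s ^ h ≤ |A| ^ h := by
      apply Real.rpow_le_rpow hs (hsA.le.trans (le_abs_self A)) h0.le
    have e0 : 0 ≤ s ^ h := Real.rpow_nonneg hs h
    calc |s ^ h * r s - c| ≤ |s ^ h * r s| + |c| := abs_sub _ _
      _ = s ^ h * |r s| + c := by rw [abs_mul, abs_of_nonneg e0, abs_of_pos hc]
      _ ≤ s ^ h * 1 + c := by gcongr; exact hr1 s hs
      _ ≤ _ := by linarith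

lemma aux_id (h c e x : ℝ) (he : 0 < e) (hx : x ≠ 0) (r : ℝ → ℝ) (hsym : ∀ u, r (-u) = r u) :
    e ^ (-h) * |r (x / e) - e ^ h * c * |x| ^ (-h)|
      = |x| ^ (-h) * |(|x| / e) ^ h * r (|x| / e) - c| := by
  have hr : r (x / e) = r (|x| / e) := by
    rcases abs_choice x with h | h <;> rw [h]
    rw [neg_div, hsym]
  have hxp : 0 < |x| := abs_pos.mpr hx
  have a1 : 0 < e ^ h := Real.rpow_pos_of_pos he h
  have a2 : 0 < |x| ^ h := Real.rpow_pos_of_pos hxp h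
  rw [hr, Real.div_rpow hxp.le he.le, Real.rpow_neg he.le, Real.rpow_neg hxp.le]
  rw [← abs_of_pos (inv_pos.mpr a1), ← abs_of_pos (inv_pos.mpr a2), ← abs_mul, ← abs_mul,
    abs_of_pos (inv_pos.mpr a2)]
  congr 1
  field_simp

/-- L¹ approximation of the rescaled long-range covariance by the fractional kernel
(final step in the proof of Proposition 5.2): if `|r| ≤ 1`, `r` is even and
`u^𝔥 r(u) → c`, then `ε^{−𝔥} ∫₀^z∫₀^z |r((u−v)/ε) − ε^𝔥 c |u−v|^{−𝔥}| du dv → 0`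
as `ε → 0⁺`. -/
theorem fractional_kernel_L1_approx (𝔥 c z : ℝ) (h𝔥 : 𝔥 ∈ Set.Ioo (0:ℝ) 1)
    (hc : 0 < c) (hz : 0 < z)
    (r : ℝ → ℝ) (hrm : Measurable r) (hsym : ∀ u, r (-u) = r u)
    (hr1 : ∀ u ≥ (0:ℝ), |r u| ≤ 1)
    (hrlim : Tendsto (fun u : ℝ => u ^ 𝔥 * r u) atTop (nhds c)) :
    Tendsto (fun ε : ℝ => ε ^ (-𝔥) *
        ∫ u in Set.Icc (0:ℝ) z, ∫ v in Set.Icc (0:ℝ) z,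
          |r ((u - v) / ε) - ε ^ 𝔥 * c * |u - v| ^ (-𝔥)|)
      (nhdsWithin 0 (Set.Ioi 0)) (nhds 0) := by
  obtain ⟨h0, h1⟩ := h𝔥
  obtain ⟨M, hM⟩ := aux_bdd 𝔥 c h0 hc r hr1 hrlim
  set φ : ℝ → ℝ → ℝ := fun ε x => |r (x / ε) - ε ^ 𝔥 * c * |x| ^ (-𝔥)| with hφ
  have hmeas : ∀ ε, Measurable (φ ε) := by
    intro ε
    simp only [hφ]
    fun_prop
  have hae : ∀ᵐ x ∂(volume.restrict (Set.Icc (-z) z)), x ≠ (0:ℝ) :=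
    ae_restrict_of_ae (Measure.ae_ne volume 0)
  have hint := aux_integrable 𝔥 z h1 hz
  have hbd : ∀ ε > 0, ∀ x ≠ 0, ‖ε ^ (-𝔥) * φ ε x‖ ≤ |x| ^ (-𝔥) * M := by
    intro ε he x hx
    simp only [hφ]
    rw [aux_id 𝔥 c ε x he hx r hsym, Real.norm_eq_abs, abs_of_nonneg (by positivity)]
    gcongr
    exact hM _ (by positivity)
  have hJ : Tendsto (fun ε => ∫ x in Set.Icc (-z) z, ε ^ (-𝔥) * φ ε x)
      (nhdsWithin 0 (Set.Ioi 0)) (nhds (∫ x in Set.Icc (-z) z, (0:ℝ))) := by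
    refine tendsto_integral_filter_of_dominated_convergence (fun x => |x| ^ (-𝔥) * M)
      ?_ ?_ (hint.mul_const M) ?_
    · exact Eventually.of_forall fun ε => ((hmeas ε).const_mul _).aestronglyMeasurable
    · filter_upwards [self_mem_nhdsWithin] with ε he
      filter_upwards [hae] with x hx using hbd ε he x hx
    · filter_upwards [hae] with x hx
      have t1 : Tendsto (fun ε : ℝ => |x| / ε) (nhdsWithin 0 (Set.Ioi 0)) atTop := by
        simp only [div_eq_mul_inv]
        exact tendsto_inv_nhdsGT_zero.const_mul_atTop (abs_pos.mpr hx)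
      have t2 := (((hrlim.comp t1).sub_const c).abs).const_mul (|x| ^ (-𝔥))
      rw [sub_self, abs_zero, mul_zero] at t2
      refine t2.congr' ?_
      filter_upwards [self_mem_nhdsWithin] with ε he
      exact (aux_id 𝔥 c ε x he hx r hsym).symm
  rw [integral_zero] at hJ
  have hJ2 := hJ.mul_const z
  rw [zero_mul] at hJ2
  refine squeeze_zero' ?_ ?_ hJ2
  · filter_upwards [self_mem_nhdsWithin] with ε he
    have he' : (0:ℝ) < ε := he
    refine mul_nonneg (by positivity) ?_
    exact integral_nonneg fun u => integral_nonneg fun v => abs_nonneg _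
  · filter_upwards [self_mem_nhdsWithin] with ε he
    have he' : (0:ℝ) < ε := he
    have hpos : 0 < ε ^ (-𝔥) := Real.rpow_pos_of_pos he' _
    have hφi : IntegrableOn (φ ε) (Set.Icc (-z) z) := by
      have : IntegrableOn (fun x => ε ^ (-𝔥) * φ ε x) (Set.Icc (-z) z) := by
        refine Integrable.mono' (hint.mul_const M)
          ((hmeas ε).const_mul _).aestronglyMeasurable ?_
        filter_upwards [hae] with x hx using hbd ε he x hx
      have h3 := this.const_mul (ε ^ (-𝔥))⁻¹
      refine h3.congr (Eventually.of_forall fun x => ?_)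
      simp only
      field_simp
    rw [integral_const_mul, mul_assoc]
    refine mul_le_mul_of_nonneg_left ?_ hpos.le
    have key : ∀ u ∈ Set.Icc (0:ℝ) z,
        ‖∫ v in Set.Icc (0:ℝ) z, φ ε (u - v)‖ ≤ ∫ x in Set.Icc (-z) z, φ ε x := by
      intro u hu
      rw [Real.norm_eq_abs, abs_of_nonneg (integral_nonneg fun v => abs_nonneg _),
        integral_Icc_eq_integral_Ioc, ← intervalIntegral.integral_of_le hz.le,
        intervalIntegral.integral_comp_sub_left (φ ε) u,
        intervalIntegral.integral_of_le (by linarith)]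
      refine setIntegral_mono_set hφi (Eventually.of_forall fun v => abs_nonneg _) ?_
      refine LE.le.eventuallyLE ?_
      intro x hx
      exact ⟨by linarith [hx.1, hu.1], by linarith [hx.2, hu.2]⟩
    have fin := norm_setIntegral_le_of_norm_le_const (μ := volume)
      (s := Set.Icc (0:ℝ) z) (by simp) key
    have e : volume.real (Set.Icc (0:ℝ) z) = z := by simp [hz.le]
    rw [e] at fin
    exact (le_abs_self _).trans fin
end

section
/- Let 𝔥 ∈ (0,1), c > 0 and z > 0, and let r : [0,∞) → ℝ be measurable with |r(u)| ≤ 1 for all u ≥ 0 and lim_{u→∞} u^𝔥 r(u) = c; extend r to ℝ by r(−u) = r(u). Then lim_{ε→0⁺} ε^{−𝔥} ∫₀^z ∫₀^z r((u−v)/ε) du dv = c ∫₀^z ∫₀^z |u−v|^{−𝔥} du dv = 2c z^{2−𝔥} / ((1−𝔥)(2−𝔥)). -/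
open MeasureTheory Filter

lemma aux_left (h u : ℝ) (h1 : h < 1) (hu : 0 ≤ u) :
    IntervalIntegrable (fun v : ℝ => |u - v| ^ (-h)) volume 0 u ∧
    ∫ v in (0:ℝ)..u, |u - v| ^ (-h) = u ^ (1 - h) / (1 - h) := by
  have hI : IntervalIntegrable (fun x : ℝ => x ^ (-h)) volume 0 u :=
    intervalIntegral.intervalIntegrable_rpow' (by linarith)
  have hI2 : IntervalIntegrable (fun v : ℝ => (u - v) ^ (-h)) volume 0 u := by
    have := (hI.comp_sub_left u).symm
    simpa using this
  have hcongr : Set.EqOn (fun v : ℝ => (u - v) ^ (-h)) (fun v : ℝ => |u - v| ^ (-h))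
      (Set.uIcc 0 u) := by
    intro v hv
    rw [Set.uIcc_of_le hu] at hv
    simp only
    rw [abs_of_nonneg (by linarith [hv.2])]
  refine ⟨hI2.congr (fun v hv => hcongr (Set.uIoc_subset_uIcc hv)), ?_⟩
  rw [← intervalIntegral.integral_congr hcongr]
  rw [intervalIntegral.integral_comp_sub_left (fun x : ℝ => x ^ (-h)) u]
  simp only [sub_self, sub_zero]
  rw [integral_rpow (Or.inl (by linarith))]
  have : -h + 1 = 1 - h := by ring
  rw [this, Real.zero_rpow (by linarith), sub_zero]

lemma aux_right (h z u : ℝ) (h1 : h < 1) (hu : u ≤ z) :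
    IntervalIntegrable (fun v : ℝ => |u - v| ^ (-h)) volume u z ∧
    ∫ v in u..z, |u - v| ^ (-h) = (z - u) ^ (1 - h) / (1 - h) := by
  obtain ⟨hI, hE⟩ := aux_left h (z - u) h1 (by linarith)
  have e : ∀ v : ℝ, |z - u - (z - v)| ^ (-h) = |u - v| ^ (-h) := by
    intro v
    rw [abs_sub_comm u v]; congr 2; ring
  constructor
  · have := (hI.comp_sub_left z).symm
    simp only [e] at this
    simpa using this
  · have := intervalIntegral.integral_comp_sub_left (a := u) (b := z)
      (fun v : ℝ => |z - u - v| ^ (-h)) z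
    simp only [e, sub_self] at this
    rw [this, hE]

lemma aux_full (h z u : ℝ) (h1 : h < 1) (hu : u ∈ Set.Icc 0 z) :
    IntegrableOn (fun v : ℝ => |u - v| ^ (-h)) (Set.Icc 0 z) ∧
    ∫ v in Set.Icc 0 z, |u - v| ^ (-h)
      = u ^ (1 - h) / (1 - h) + (z - u) ^ (1 - h) / (1 - h) := by
  obtain ⟨a, b⟩ := aux_left h u h1 hu.1
  obtain ⟨a', b'⟩ := aux_right h z u h1 hu.2
  have hz : (0:ℝ) ≤ z := hu.1.trans hu.2
  constructor
  · rw [integrableOn_Icc_iff_integrableOn_Ioc, ← intervalIntegrable_iff_integrableOn_Ioc_of_le hz]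
    exact a.trans a'
  · rw [integral_Icc_eq_integral_Ioc, ← intervalIntegral.integral_of_le hz,
      ← intervalIntegral.integral_add_adjacent_intervals a a', b, b']

lemma aux_cont (h z : ℝ) (h1 : h < 1) :
    Continuous (fun u : ℝ => u ^ (1 - h) / (1 - h) + (z - u) ^ (1 - h) / (1 - h)) := by
  have e : (0:ℝ) ≤ 1 - h := by linarith
  exact ((Real.continuous_rpow_const e).div_const _).add
    (((Real.continuous_rpow_const e).comp (continuous_const.sub continuous_id)).div_const _)

lemma aux_double (h z : ℝ) (h1 : h < 1) (hz : 0 < z) :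
    ∫ u in Set.Icc (0:ℝ) z, ∫ v in Set.Icc (0:ℝ) z, |u - v| ^ (-h)
      = 2 * z ^ (2 - h) / ((1 - h) * (2 - h)) := by
  rw [setIntegral_congr_fun measurableSet_Icc (fun u hu => (aux_full h z u h1 hu).2)]
  have e : (0:ℝ) ≤ 1 - h := by linarith
  have c1 : Continuous (fun u : ℝ => u ^ (1 - h)) := Real.continuous_rpow_const e
  have c2 : Continuous (fun u : ℝ => (z - u) ^ (1 - h)) :=
    c1.comp (continuous_const.sub continuous_id)
  rw [integral_Icc_eq_integral_Ioc, ← intervalIntegral.integral_of_le hz.le,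
    intervalIntegral.integral_add ((c1.div_const _).intervalIntegrable _ _)
      ((c2.div_const _).intervalIntegrable _ _),
    intervalIntegral.integral_div, intervalIntegral.integral_div,
    intervalIntegral.integral_comp_sub_left (fun x : ℝ => x ^ (1 - h)) z]
  simp only [sub_self, sub_zero]
  rw [integral_rpow (Or.inl (by linarith))]
  have : 1 - h + 1 = 2 - h := by ring
  rw [this, Real.zero_rpow (by linarith), sub_zero]
  have : 1 - h ≠ 0 := by linarith
  have : 2 - h ≠ 0 := by linarith
  field_simp
  ring

lemma aux_bound (h c : ℝ) (r : ℝ → ℝ) (h0 : 0 < h) (hr1 : ∀ u ≥ (0:ℝ), |r u| ≤ 1)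
    (hrlim : Tendsto (fun u : ℝ => u ^ h * r u) atTop (nhds c)) :
    ∃ K : ℝ, ∀ x ≥ (0:ℝ), |x ^ h * r x| ≤ K := by
  have := hrlim.abs.eventually (gt_mem_nhds (lt_add_one |c|))
  obtain ⟨M, hM⟩ := eventually_atTop.1 this
  refine ⟨max (|c| + 1) (M ^ h), fun x hx => ?_⟩
  rcases le_total M x with hl | hl
  · exact le_max_of_le_left (hM x hl).le
  · apply le_max_of_le_right
    rw [abs_mul, abs_of_nonneg (Real.rpow_nonneg hx h)]
    calc x ^ h * |r x| ≤ x ^ h * 1 :=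
          mul_le_mul_of_nonneg_left (hr1 x hx) (Real.rpow_nonneg hx h)
      _ = x ^ h := mul_one _
      _ ≤ M ^ h := Real.rpow_le_rpow hx hl h0.le

lemma aux_eq (h : ℝ) (r : ℝ → ℝ) (hsym : ∀ u, r (-u) = r u) (ε x : ℝ) (hε : 0 < ε) (hx : x ≠ 0) :
    ε ^ (-h) * r (x / ε) = |x| ^ (-h) * ((|x| / ε) ^ h * r (|x| / ε)) := by
  have e : r (x / ε) = r (|x| / ε) := by
    rcases abs_choice x with H | H
    · rw [H]
    · rw [H, neg_div, hsym]
  have hx' : 0 < |x| := abs_pos.2 hx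
  rw [e, Real.div_rpow hx'.le hε.le, Real.rpow_neg hε.le, Real.rpow_neg hx'.le]
  have := (Real.rpow_pos_of_pos hx' h).ne'
  have := (Real.rpow_pos_of_pos hε h).ne'
  field_simp

/-- Variance asymptotics producing the fractional scaling `z^{2H}`, `H = 1 − 𝔥/2`:
if `|r| ≤ 1`, `r` is even and `u^𝔥 r(u) → c`, then
`ε^{−𝔥} ∫₀^z∫₀^z r((u−v)/ε) du dv → c ∫₀^z∫₀^z |u−v|^{−𝔥} du dv
  = 2c z^{2−𝔥}/((1−𝔥)(2−𝔥))`. -/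
theorem fractional_variance_asymptotics (𝔥 c z : ℝ) (h𝔥 : 𝔥 ∈ Set.Ioo (0:ℝ) 1)
    (hc : 0 < c) (hz : 0 < z)
    (r : ℝ → ℝ) (hrm : Measurable r) (hsym : ∀ u, r (-u) = r u)
    (hr1 : ∀ u ≥ (0:ℝ), |r u| ≤ 1)
    (hrlim : Tendsto (fun u : ℝ => u ^ 𝔥 * r u) atTop (nhds c)) :
    Tendsto (fun ε : ℝ => ε ^ (-𝔥) *
        ∫ u in Set.Icc (0:ℝ) z, ∫ v in Set.Icc (0:ℝ) z, r ((u - v) / ε))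
      (nhdsWithin 0 (Set.Ioi 0))
      (nhds (c * ∫ u in Set.Icc (0:ℝ) z, ∫ v in Set.Icc (0:ℝ) z, |u - v| ^ (-𝔥))) ∧
    c * ∫ u in Set.Icc (0:ℝ) z, ∫ v in Set.Icc (0:ℝ) z, |u - v| ^ (-𝔥)
      = 2 * c * z ^ (2 - 𝔥) / ((1 - 𝔥) * (2 - 𝔥)) := by
  obtain ⟨h0, h1⟩ := h𝔥
  refine ⟨?_, by rw [aux_double 𝔥 z h1 hz]; ring⟩
  obtain ⟨K, hK⟩ := aux_bound 𝔥 c r h0 hr1 hrlim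
  have hne : ∀ u : ℝ, ∀ᵐ v ∂(volume.restrict (Set.Icc (0:ℝ) z)), u - v ≠ 0 := by
    intro u
    apply ae_restrict_of_ae
    filter_upwards [Measure.ae_ne volume u] with v hv
    exact sub_ne_zero.2 (Ne.symm hv)
  have hb : ∀ ε > (0:ℝ), ∀ u v : ℝ, u - v ≠ 0 →
      ‖ε ^ (-𝔥) * r ((u - v) / ε)‖ ≤ K * |u - v| ^ (-𝔥) := by
    intro ε hε u v huv
    rw [aux_eq 𝔥 r hsym ε _ hε huv, norm_mul, Real.norm_eq_abs, Real.norm_eq_abs,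
      abs_of_nonneg (Real.rpow_nonneg (abs_nonneg _) _), mul_comm]
    exact mul_le_mul_of_nonneg_right (hK _ (by positivity)) (Real.rpow_nonneg (abs_nonneg _) _)
  have hpos : ∀ᶠ ε : ℝ in nhdsWithin 0 (Set.Ioi 0), 0 < ε := self_mem_nhdsWithin
  simp_rw [← integral_const_mul]
  apply tendsto_integral_filter_of_dominated_convergence
    (fun u => K * (u ^ (1 - 𝔥) / (1 - 𝔥) + (z - u) ^ (1 - 𝔥) / (1 - 𝔥)))
  · refine Eventually.of_forall fun ε => ?_
    have hm : StronglyMeasurable (Function.uncurry fun u v : ℝ => ε ^ (-𝔥) * r ((u - v) / ε)) := by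
      apply Measurable.stronglyMeasurable
      exact (hrm.comp ((measurable_fst.sub measurable_snd).div_const ε)).const_mul _
    exact hm.integral_prod_right.aestronglyMeasurable
  · filter_upwards [hpos] with ε hε
    filter_upwards [ae_restrict_mem measurableSet_Icc] with u hu
    obtain ⟨hi, hv⟩ := aux_full 𝔥 z u h1 hu
    rw [← hv, ← integral_const_mul]
    apply norm_integral_le_of_norm_le (hi.const_mul K)
    filter_upwards [hne u] with v hv using hb ε hε u v hv
  · exact ((aux_cont 𝔥 z h1).const_mul K).integrableOn_Icc
  · filter_upwards [ae_restrict_mem measurableSet_Icc] with u hu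
    obtain ⟨hi, -⟩ := aux_full 𝔥 z u h1 hu
    apply tendsto_integral_filter_of_dominated_convergence (fun v => K * |u - v| ^ (-𝔥))
    · refine Eventually.of_forall fun ε => ?_
      exact ((hrm.comp ((measurable_const.sub measurable_id).div_const ε)).const_mul
        _).aestronglyMeasurable
    · filter_upwards [hpos] with ε hε
      filter_upwards [hne u] with v hv using hb ε hε u v hv
    · exact hi.const_mul K
    · filter_upwards [hne u] with v hv
      have hl : Tendsto (fun ε : ℝ => |u - v| / ε) (nhdsWithin 0 (Set.Ioi 0)) atTop := by
        simp_rw [div_eq_mul_inv]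
        exact tendsto_inv_nhdsGT_zero.const_mul_atTop (abs_pos.2 hv)
      have := (hrlim.comp hl).const_mul (|u - v| ^ (-𝔥))
      rw [mul_comm c]
      refine this.congr' ?_
      filter_upwards [hpos] with ε hε
      exact (aux_eq 𝔥 r hsym ε _ hε hv).symm
end

section
/- Let 𝔥 ∈ (0,1), z > 0, K > 0 and z_e > 0, and let r : [0,∞) → ℝ be measurable with |r(u)| ≤ 1 for all u ≥ 0 and |r(u)| ≤ K u^{−𝔥} for all u ≥ z_e; extend r to ℝ by r(−u) = r(u). Then there exists a constant C > 0 such that for all ε ∈ (0,1/2]: ∫₀^z ∫₀^z r((u−v)/ε)² du dv ≤ C ε^{2𝔥} if 𝔥 ∈ (0,1/2); ≤ C ε log(1/ε) if 𝔥 = 1/2; and ≤ C ε if 𝔥 ∈ (1/2,1). -/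
open MeasureTheory

lemma sce_pointwise (h K ze : ℝ) (h0 : 0 < h) (hze : 0 < ze)
    (r : ℝ → ℝ)
    (hr1 : ∀ u ≥ (0:ℝ), |r u| ≤ 1) (hr2 : ∀ u ≥ ze, |r u| ≤ K * u ^ (-h)) :
    ∃ M > (0:ℝ), ∀ x ≥ (0:ℝ), (r x) ^ 2 ≤ M * (1 + x) ^ (-(2 * h)) := by
  have hc : 0 < ze / (1 + ze) := by positivity
  refine ⟨(1 + ze) ^ (2 * h) + K ^ 2 * (ze / (1 + ze)) ^ (-(2 * h)), by positivity, ?_⟩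
  intro x hx
  have hpos : 0 < (1 + x) ^ (-(2 * h)) := by positivity
  rw [add_mul]
  rcases le_total x ze with hxz | hxz
  · have h1 : (r x) ^ 2 ≤ 1 := by
      rw [sq_le_one_iff_abs_le_one]; exact hr1 x hx
    have h2 : (1:ℝ) ≤ (1 + ze) ^ (2 * h) * (1 + x) ^ (-(2 * h)) := by
      rw [Real.rpow_neg (by positivity), ← div_eq_mul_inv, one_le_div (by positivity)]
      gcongr
    have h3 : 0 ≤ K ^ 2 * (ze / (1 + ze)) ^ (-(2 * h)) * (1 + x) ^ (-(2 * h)) := by positivity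
    linarith
  · have hx0 : 0 < x := lt_of_lt_of_le hze hxz
    have h1 : (r x) ^ 2 ≤ (K * x ^ (-h)) ^ 2 := by
      rw [← sq_abs]
      exact pow_le_pow_left₀ (abs_nonneg _) (hr2 x hxz) 2
    have h2 : (K * x ^ (-h)) ^ 2 = K ^ 2 * x ^ (-(2 * h)) := by
      rw [mul_pow, ← Real.rpow_mul_natCast hx0.le]
      congr 2; push_cast; ring
    have h3 : x ^ (-(2 * h)) ≤ (ze / (1 + ze)) ^ (-(2 * h)) * (1 + x) ^ (-(2 * h)) := by
      rw [← Real.mul_rpow hc.le (by positivity)]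
      apply Real.rpow_le_rpow_of_nonpos (by positivity) _ (by linarith)
      rw [div_mul_eq_mul_div, div_le_iff₀ (by positivity)]
      nlinarith
    have h4 : 0 ≤ (1 + ze) ^ (2 * h) * (1 + x) ^ (-(2 * h)) := by positivity
    have h5 := mul_le_mul_of_nonneg_left h3 (sq_nonneg K)
    linarith

lemma sce_main (h z M : ℝ) (hz : 0 < z) (hM : 0 < M)
    (r : ℝ → ℝ) (hrm : Measurable r) (hsym : ∀ u, r (-u) = r u)
    (hr1 : ∀ u ≥ (0:ℝ), |r u| ≤ 1)
    (hb : ∀ x ≥ (0:ℝ), (r x) ^ 2 ≤ M * (1 + x) ^ (-(2 * h))) (ε : ℝ) (hε : 0 < ε) :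
    ∫ u in Set.Icc (0:ℝ) z, ∫ v in Set.Icc (0:ℝ) z, (r ((u - v) / ε)) ^ 2
      ≤ (2 * z * M) * (ε * ∫ x in (1:ℝ)..(1 + z / ε), x ^ (-(2 * h))) := by
  have hall : ∀ u, (r u) ^ 2 ≤ 1 := by
    intro u
    rw [sq_le_one_iff_abs_le_one]
    rcases le_total 0 u with hu | hu
    · exact hr1 u hu
    · rw [← hsym]; exact hr1 _ (by linarith)
  have hint : ∀ a b : ℝ, IntervalIntegrable (fun w => (r (w / ε)) ^ 2) volume a b := by
    intro a b
    apply (intervalIntegrable_const (c := (1:ℝ))).mono_fun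
    · exact ((hrm.comp (measurable_id.div_const ε)).pow_const 2).aestronglyMeasurable
    · refine Filter.Eventually.of_forall fun x => ?_
      simpa using hall (x / ε)
  have hint1 : ∀ a b : ℝ, IntervalIntegrable (fun w => (r w) ^ 2) volume a b := by
    intro a b
    apply (intervalIntegrable_const (c := (1:ℝ))).mono_fun
    · exact (hrm.pow_const 2).aestronglyMeasurable
    · refine Filter.Eventually.of_forall fun x => ?_
      simpa using hall x
  set J := ∫ x in (1:ℝ)..(1 + z / ε), x ^ (-(2 * h)) with hJ
  have hze : 0 ≤ z / ε := by positivity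
  have hhalf : ∫ w in (0:ℝ)..z, (r (w / ε)) ^ 2 ≤ M * (ε * J) := by
    rw [intervalIntegral.integral_comp_div (fun x => (r x) ^ 2) hε.ne', zero_div, smul_eq_mul]
    have : ∫ x in (0:ℝ)..(z / ε), (r x) ^ 2 ≤ ∫ x in (0:ℝ)..(z / ε), M * (1 + x) ^ (-(2 * h)) := by
      apply intervalIntegral.integral_mono_on hze (hint1 _ _)
      · apply ContinuousOn.intervalIntegrable
        apply ContinuousOn.mul continuousOn_const
        apply ContinuousOn.rpow_const (by fun_prop)
        intro x hx
        rw [Set.uIcc_of_le hze] at hx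
        left; linarith [hx.1]
      · intro x hx; exact hb x hx.1
    rw [intervalIntegral.integral_const_mul,
      intervalIntegral.integral_comp_add_left (fun x => x ^ (-(2 * h))) 1, add_zero, ← hJ] at this
    calc _ ≤ ε * (M * J) := by gcongr
      _ = _ := by ring
  have hneg : ∫ w in (-z)..0, (r (w / ε)) ^ 2 = ∫ w in (0:ℝ)..z, (r (w / ε)) ^ 2 := by
    have := intervalIntegral.integral_comp_neg (a := (0:ℝ)) (b := z) (fun w => (r (w / ε)) ^ 2)
    rw [neg_zero] at this
    rw [← this]
    simp only [neg_div, hsym]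
  have hfull : ∫ w in (-z)..z, (r (w / ε)) ^ 2 ≤ 2 * M * (ε * J) := by
    rw [← intervalIntegral.integral_add_adjacent_intervals (hint (-z) 0) (hint 0 z), hneg]
    linarith
  have hinner : ∀ u ∈ Set.Icc (0:ℝ) z,
      ‖∫ v in Set.Icc (0:ℝ) z, (r ((u - v) / ε)) ^ 2‖ ≤ 2 * M * (ε * J) := by
    intro u hu
    rw [Real.norm_of_nonneg (integral_nonneg fun _ => sq_nonneg _), integral_Icc_eq_integral_Ioc,
      ← intervalIntegral.integral_of_le hz.le,
      intervalIntegral.integral_comp_sub_left (fun w => (r (w / ε)) ^ 2) u, sub_zero]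
    refine le_trans ?_ hfull
    apply intervalIntegral.integral_mono_interval (by linarith [hu.1]) (by linarith) hu.2
      (Filter.Eventually.of_forall fun _ => sq_nonneg _) (hint _ _)
  have := norm_setIntegral_le_of_norm_le_const (μ := volume) (by simp) hinner
  refine (le_abs_self _).trans (this.trans (le_of_eq ?_))
  rw [Real.volume_real_Icc_of_le hz.le]; ring

theorem squared_correlation_estimate (𝔥 z K ze : ℝ) (h𝔥 : 𝔥 ∈ Set.Ioo (0:ℝ) 1)
    (hz : 0 < z) (hK : 0 < K) (hze : 0 < ze)
    (r : ℝ → ℝ) (hrm : Measurable r) (hsym : ∀ u, r (-u) = r u)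
    (hr1 : ∀ u ≥ (0:ℝ), |r u| ≤ 1) (hr2 : ∀ u ≥ ze, |r u| ≤ K * u ^ (-𝔥)) :
    ∃ C > (0:ℝ), ∀ ε ∈ Set.Ioc (0:ℝ) (1/2),
      (𝔥 < 1/2 →
        ∫ u in Set.Icc (0:ℝ) z, ∫ v in Set.Icc (0:ℝ) z, (r ((u - v) / ε)) ^ 2
          ≤ C * ε ^ (2 * 𝔥)) ∧
      (𝔥 = 1/2 →
        ∫ u in Set.Icc (0:ℝ) z, ∫ v in Set.Icc (0:ℝ) z, (r ((u - v) / ε)) ^ 2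
          ≤ C * ε * Real.log (1 / ε)) ∧
      (1/2 < 𝔥 →
        ∫ u in Set.Icc (0:ℝ) z, ∫ v in Set.Icc (0:ℝ) z, (r ((u - v) / ε)) ^ 2
          ≤ C * ε) := by
  obtain ⟨M, hM, hb⟩ := sce_pointwise 𝔥 K ze h𝔥.1 hze r hr1 hr2
  have main := sce_main 𝔥 z M hz hM r hrm hsym hr1 hb
  have hA : 0 < 2 * z * M := by positivity
  have hJ : 𝔥 ≠ 1/2 → ∀ ε : ℝ, 0 < ε → ∫ x in (1:ℝ)..(1 + z / ε), x ^ (-(2 * 𝔥))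
      = ((1 + z / ε) ^ (1 - 2 * 𝔥) - 1) / (1 - 2 * 𝔥) := by
    intro hne ε hε
    have hzε : 0 < z / ε := by positivity
    rw [integral_rpow]
    · rw [Real.one_rpow, show -(2 * 𝔥) + 1 = 1 - 2 * 𝔥 by ring]
    · right
      refine ⟨fun h => hne (by linarith), ?_⟩
      rw [Set.uIcc_of_le (by linarith)]
      intro h; linarith [h.1]
  rcases lt_trichotomy 𝔥 (1/2) with hh | hh | hh
  · have hd : 0 < 1 - 2 * 𝔥 := by linarith
    refine ⟨2 * z * M * ((1 + z) ^ (1 - 2 * 𝔥) / (1 - 2 * 𝔥)), by positivity, ?_⟩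
    rintro ε ⟨hε, hε2⟩
    refine ⟨fun _ => ?_, fun h => by linarith, fun h => by linarith⟩
    refine (main ε hε).trans ?_
    rw [mul_assoc (2 * z * M)]
    refine mul_le_mul_of_nonneg_left ?_ hA.le
    rw [hJ hh.ne ε hε, mul_div_assoc', div_mul_eq_mul_div]
    refine div_le_div_of_nonneg_right ?_ hd.le
    have h1 : (1 + z / ε) ^ (1 - 2 * 𝔥) ≤ ((1 + z) / ε) ^ (1 - 2 * 𝔥) := by
      apply Real.rpow_le_rpow (by positivity) _ hd.le
      rw [add_div]
      have : 1 ≤ 1 / ε := by rw [le_div_iff₀ hε]; linarith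
      linarith
    have h2 : ε * ((1 + z) / ε) ^ (1 - 2 * 𝔥) = (1 + z) ^ (1 - 2 * 𝔥) * ε ^ (2 * 𝔥) := by
      rw [Real.div_rpow (by positivity) hε.le, Real.rpow_sub hε, Real.rpow_one]
      field_simp
    rw [← h2]
    gcongr
    linarith
  · have hl2 : 0 < Real.log 2 := Real.log_pos (by norm_num)
    have hlz : 0 < Real.log (1 + z) := Real.log_pos (by linarith)
    refine ⟨2 * z * M * (1 + Real.log (1 + z) / Real.log 2), by positivity, ?_⟩
    rintro ε ⟨hε, hε2⟩
    refine ⟨fun h => by linarith, fun _ => ?_, fun h => by linarith⟩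
    refine (main ε hε).trans ?_
    have hzε : 0 < z / ε := by positivity
    have e1 : ∫ x in (1:ℝ)..(1 + z / ε), x ^ (-(2 * 𝔥)) = Real.log (1 + z / ε) := by
      rw [hh, show -(2 * (1 / 2 : ℝ)) = -1 by norm_num]
      simp only [Real.rpow_neg_one]
      rw [integral_inv_of_pos (by norm_num) (by positivity), div_one]
    rw [e1, mul_assoc (2 * z * M), mul_assoc (2 * z * M)]
    refine mul_le_mul_of_nonneg_left ?_ hA.le
    have h1 : Real.log (1 + z / ε) ≤ Real.log (1 + z) + Real.log (1 / ε) := by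
      rw [← Real.log_mul (by positivity) (by positivity)]
      apply Real.log_le_log (by positivity)
      have : 1 ≤ 1 / ε := by rw [le_div_iff₀ hε]; linarith
      rw [add_mul, one_mul, mul_one_div z]; linarith
    have h2 : Real.log 2 ≤ Real.log (1 / ε) := by
      apply Real.log_le_log (by norm_num)
      rw [le_div_iff₀ hε]; linarith
    have h3 : Real.log (1 + z) ≤ Real.log (1 + z) / Real.log 2 * Real.log (1 / ε) := by
      rw [div_mul_eq_mul_div, le_div_iff₀ hl2]
      gcongr
    calc ε * Real.log (1 + z / ε)
        ≤ ε * (Real.log (1 + z) / Real.log 2 * Real.log (1 / ε) + Real.log (1 / ε)) := by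
          gcongr; linarith
      _ = _ := by ring
  · have hd : 0 < 2 * 𝔥 - 1 := by linarith
    refine ⟨2 * z * M * (1 / (2 * 𝔥 - 1)), by positivity, ?_⟩
    rintro ε ⟨hε, hε2⟩
    refine ⟨fun h => by linarith, fun h => by linarith, fun _ => ?_⟩
    refine (main ε hε).trans ?_
    rw [mul_assoc (2 * z * M)]
    refine mul_le_mul_of_nonneg_left ?_ hA.le
    rw [hJ hh.ne' ε hε, mul_comm]
    refine mul_le_mul_of_nonneg_right ?_ hε.le
    rw [← neg_div_neg_eq _ (1 - 2 * 𝔥), show -(1 - 2 * 𝔥) = 2 * 𝔥 - 1 by ring]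
    refine div_le_div_of_nonneg_right ?_ hd.le
    have : 0 ≤ (1 + z / ε) ^ (1 - 2 * 𝔥) := by positivity
    linarith
end

section
/- Let α ∈ (0,1), β ∈ (1−α, 1], L > 0 and M ≥ 0, and let g : [0,L] → ℝ satisfy |g(t) − g(s)| ≤ M |t−s|^β for all s, t ∈ [0,L]. Then for all 0 ≤ s < t ≤ L, |g(t) − g(s)|/(t−s)^{1−α} + (1−α) ∫_s^t |g(y) − g(s)|/(y−s)^{2−α} dy ≤ M (1 + (1−α)/(α+β−1)) (t−s)^{α+β−1}; in particular the supremum of the left-hand side over all 0 ≤ s < t ≤ L is at most M (1 + (1−α)/(α+β−1)) L^{α+β−1}. -/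
open MeasureTheory

/-- Deterministic core of Lemma "techBA": a `β`-Hölder path `g` with `β > 1 − α`
has finite Weyl–Marchaud quantity: for `0 ≤ s < t ≤ L`,
`|g(t)−g(s)|/(t−s)^{1−α} + (1−α)∫_s^t |g(y)−g(s)|/(y−s)^{2−α} dy
  ≤ M (1 + (1−α)/(α+β−1)) (t−s)^{α+β−1} ≤ M (1 + (1−α)/(α+β−1)) L^{α+β−1}`. -/
theorem holder_weyl_marchaud_bound (α β L M : ℝ) (hα : α ∈ Set.Ioo (0:ℝ) 1)
    (hβ : β ∈ Set.Ioc (1 - α) 1) (hL : 0 < L) (hM : 0 ≤ M)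
    (g : ℝ → ℝ)
    (hg : ∀ s ∈ Set.Icc (0:ℝ) L, ∀ t ∈ Set.Icc (0:ℝ) L,
      |g t - g s| ≤ M * |t - s| ^ β) :
    ∀ s t : ℝ, 0 ≤ s → s < t → t ≤ L →
      |g t - g s| / (t - s) ^ (1 - α)
          + (1 - α) * ∫ y in Set.Ioc s t, |g y - g s| / (y - s) ^ (2 - α)
        ≤ M * (1 + (1 - α) / (α + β - 1)) * (t - s) ^ (α + β - 1) ∧
      M * (1 + (1 - α) / (α + β - 1)) * (t - s) ^ (α + β - 1)
        ≤ M * (1 + (1 - α) / (α + β - 1)) * L ^ (α + β - 1) := by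
  intro s t hs hst htL
  obtain ⟨hα0, hα1⟩ := hα
  obtain ⟨hβ0, hβ1⟩ := hβ
  have hγ : 0 < α + β - 1 := by linarith
  have hts : 0 < t - s := by linarith
  have key : ∀ y, s < y → y ≤ L → |g y - g s| ≤ M * (y - s) ^ β := by
    intro y h1 h2
    have h := hg s ⟨hs, by linarith⟩ y ⟨by linarith, h2⟩
    rwa [abs_of_pos (by linarith : 0 < y - s)] at h
  have hint0 : IntervalIntegrable (fun y : ℝ => y ^ (α + β - 2)) volume (s - s) (t - s) :=
    intervalIntegral.intervalIntegrable_rpow' (by linarith)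
  have hint1 : IntervalIntegrable (fun y : ℝ => (y - s) ^ (α + β - 2)) volume s t := by
    have h := hint0.comp_sub_right s
    simpa using h
  have hint : IntegrableOn (fun y : ℝ => M * (y - s) ^ (α + β - 2)) (Set.Ioc s t) volume :=
    ((intervalIntegrable_iff_integrableOn_Ioc_of_le hst.le).1 hint1).const_mul M
  have hval : ∫ y in Set.Ioc s t, M * (y - s) ^ (α + β - 2)
      = M * ((t - s) ^ (α + β - 1) / (α + β - 1)) := by
    rw [integral_const_mul, ← intervalIntegral.integral_of_le hst.le,
      intervalIntegral.integral_comp_sub_right (fun y : ℝ => y ^ (α + β - 2)) s,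
      integral_rpow (Or.inl (by linarith)), sub_self,
      show α + β - 2 + 1 = α + β - 1 by ring, Real.zero_rpow hγ.ne', sub_zero]
  have hI : ∫ y in Set.Ioc s t, |g y - g s| / (y - s) ^ (2 - α)
      ≤ M * ((t - s) ^ (α + β - 1) / (α + β - 1)) := by
    rw [← hval]
    refine integral_mono_of_nonneg ?_ hint ?_
    · filter_upwards [ae_restrict_mem measurableSet_Ioc] with y hy
      have : 0 < y - s := by linarith [hy.1]
      simp only [Pi.zero_apply]
      positivity
    · filter_upwards [ae_restrict_mem measurableSet_Ioc] with y hy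
      have h0 : 0 < y - s := by linarith [hy.1]
      rw [div_le_iff₀ (by positivity), mul_assoc, ← Real.rpow_add h0,
        show α + β - 2 + (2 - α) = β by ring]
      exact key y hy.1 (hy.2.trans htL)
  have hF : |g t - g s| / (t - s) ^ (1 - α) ≤ M * (t - s) ^ (α + β - 1) := by
    rw [div_le_iff₀ (by positivity), mul_assoc, ← Real.rpow_add hts,
      show α + β - 1 + (1 - α) = β by ring]
    exact key t hst htL
  constructor
  · calc _ ≤ M * (t - s) ^ (α + β - 1)
          + (1 - α) * (M * ((t - s) ^ (α + β - 1) / (α + β - 1))) :=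
          add_le_add hF (mul_le_mul_of_nonneg_left hI (by linarith))
      _ = _ := by ring
  · have h1 : 0 ≤ (1 - α) / (α + β - 1) := div_nonneg (by linarith) hγ.le
    exact mul_le_mul_of_nonneg_left
      (Real.rpow_le_rpow hts.le (by linarith) hγ.le) (by positivity)
end

section
/- Let L > 0 and k ∈ ℝ with k ≠ 0. Let μ be a finite complex Borel measure on ℝ² satisfying μ(−E) = conj(μ(E)) for every Borel set E ⊂ ℝ², and let b : [0,L] × ℝ² → ℝ be bounded measurable with b(z,−q) = b(z,q) for all z ∈ [0,L] and q ∈ ℝ². Let X : [0,L] → L²(ℝ²;ℂ) be continuously differentiable and suppose that for every z ∈ [0,L] its derivative satisfies, for almost every κ ∈ ℝ², (dX/dz)(z)(κ) = i k ∫_{ℝ²} exp( −i (|κ−q|² − |κ|²) z/(2k) ) b(z,q) X(z)(κ−q) μ(dq). Then ‖X(z)‖_{L²(ℝ²)} = ‖X(0)‖_{L²(ℝ²)} for every z ∈ [0,L]. -/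
open MeasureTheory

lemma aux_skew {E : Type*} [NormedAddCommGroup E] [MeasureSpace E] [BorelSpace E]
    [SecondCountableTopology E] [(volume : Measure E).IsAddRightInvariant]
    [SFinite (volume : Measure E)]
    (μ : Measure E) [IsFiniteMeasure μ] (hμsym : μ.map (fun q => -q) = μ) :
    MeasurePreserving (fun p : E × E => (-p.1, p.2 - p.1)) (μ.prod volume) (μ.prod volume) := by
  have h1 : MeasurePreserving (fun q : E => -q) μ μ := ⟨measurable_neg, hμsym⟩
  refine h1.skew_product (g := fun q κ => κ - q) ?_ ?_
  · exact measurable_snd.sub measurable_fst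
  · exact Filter.Eventually.of_forall fun q => (measurePreserving_sub_right volume q).map_eq

lemma aux_re {E : Type*} [NormedAddCommGroup E] [MeasureSpace E] [BorelSpace E]
    [SecondCountableTopology E] [(volume : Measure E).IsAddRightInvariant]
    [SFinite (volume : Measure E)]
    (μ : Measure E) [IsFiniteMeasure μ] (hμsym : μ.map (fun q => -q) = μ)
    (x : E → ℂ) (hx : StronglyMeasurable x) (hx2 : Integrable (fun κ => ‖x κ‖ ^ 2))
    (m : E → E → ℂ) (hm : Measurable (Function.uncurry m)) (C : ℝ)
    (hC : ∀ q κ, ‖m q κ‖ ≤ C)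
    (hsym : ∀ q κ, m (-q) (κ - q) = starRingEnd ℂ (m q κ)) :
    starRingEnd ℂ (∫ κ, (∫ q, m q κ * x (κ - q) ∂μ) * starRingEnd ℂ (x κ)) =
      ∫ κ, (∫ q, m q κ * x (κ - q) ∂μ) * starRingEnd ℂ (x κ) := by
  have hT := aux_skew μ hμsym
  set F : E × E → ℂ := fun p => m p.1 p.2 * x (p.2 - p.1) * starRingEnd ℂ (x p.2) with hF
  have hxm := hx.measurable
  have hFm : Measurable F := by
    have h1 : Measurable fun p : E × E => m p.1 p.2 := hm
    have h2 : Measurable fun p : E × E => x (p.2 - p.1) :=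
      hxm.comp (measurable_snd.sub measurable_fst)
    have h3 : Measurable fun p : E × E => starRingEnd ℂ (x p.2) :=
      Complex.continuous_conj.measurable.comp (hxm.comp measurable_snd)
    exact (h1.mul h2).mul h3
  have hI1 : Integrable (fun p : E × E => ‖x p.2‖ ^ 2) (μ.prod volume) := hx2.comp_snd μ
  have hI2 : Integrable (fun p : E × E => ‖x (p.2 - p.1)‖ ^ 2) (μ.prod volume) :=
    hT.integrable_comp_of_integrable hI1
  have hFi : Integrable F (μ.prod volume) := by
    refine Integrable.mono' ((hI1.add hI2).const_mul C) hFm.aestronglyMeasurable ?_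
    refine Filter.Eventually.of_forall fun p => ?_
    have h0 := hC p.1 p.2
    have h00 := norm_nonneg (m p.1 p.2)
    simp only [hF, norm_mul, RCLike.norm_conj, Pi.add_apply]
    rw [mul_assoc]
    have := norm_nonneg (x p.2)
    have := norm_nonneg (x (p.2 - p.1))
    apply mul_le_mul h0 _ (by positivity) (h00.trans h0)
    nlinarith [sq_nonneg (‖x p.2‖ - ‖x (p.2 - p.1)‖), sq_nonneg (‖x p.2‖), sq_nonneg (‖x (p.2 - p.1)‖)]
  have hS : ∫ κ, (∫ q, m q κ * x (κ - q) ∂μ) * starRingEnd ℂ (x κ) = ∫ p, F p ∂(μ.prod volume) := by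
    rw [integral_prod_symm _ hFi]
    refine integral_congr_ae (Filter.Eventually.of_forall fun κ => ?_)
    simp only [hF]
    rw [integral_mul_const]
  rw [hS, ← integral_conj]
  have hinv : ∫ p, F (-p.1, p.2 - p.1) ∂(μ.prod volume) = ∫ p, F p ∂(μ.prod volume) := by
    have := integral_map (μ := μ.prod volume) hT.measurable.aemeasurable
      (f := F) hFm.aestronglyMeasurable
    rw [hT.map_eq] at this
    exact this.symm
  rw [← hinv]
  refine integral_congr_ae (Filter.Eventually.of_forall fun p => ?_)
  simp only [hF, map_mul, hsym, Complex.conj_conj, sub_neg_eq_add, sub_add_cancel]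
  ring

/-- Pathwise conservation of the `L²` norm for the Fourier-domain paraxial evolution
(Proposition 7.1 / Lemma "consXe"). The finite complex Borel measure of the statement
is represented as `g dμ` where `μ` is a finite (positive) Borel measure and `g` a
bounded measurable complex density; the conjugation symmetry `μ_ℂ(−E) = conj(μ_ℂ(E))`
corresponds to `μ` being invariant under `q ↦ −q` together with `g(−q) = conj(g(q))`.
If `X : [0,L] → L²(ℝ²;ℂ)` is continuously differentiable and satisfies, for a.e. `κ`,
`X'(z)(κ) = ik ∫ exp(−i(|κ−q|²−|κ|²)z/(2k)) b(z,q) X(z)(κ−q) g(q) μ(dq)`,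
then `‖X(z)‖_{L²} = ‖X(0)‖_{L²}` on `[0,L]`. -/
theorem paraxial_L2_conservation (L k : ℝ) (hL : 0 < L) (hk : k ≠ 0)
    (μ : Measure (EuclideanSpace ℝ (Fin 2))) [IsFiniteMeasure μ]
    (hμsym : μ.map (fun q => -q) = μ)
    (g : EuclideanSpace ℝ (Fin 2) → ℂ) (hgm : Measurable g)
    (hgb : ∃ C, ∀ q, ‖g q‖ ≤ C)
    (hgsym : ∀ q, g (-q) = starRingEnd ℂ (g q))
    (b : ℝ → EuclideanSpace ℝ (Fin 2) → ℝ)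
    (hbm : Measurable (Function.uncurry b))
    (hbb : ∃ C, ∀ z q, |b z q| ≤ C)
    (hbsym : ∀ z q, b z (-q) = b z q)
    (X X' : ℝ → Lp ℂ 2 (volume : Measure (EuclideanSpace ℝ (Fin 2))))
    (hX : ∀ z ∈ Set.Icc (0:ℝ) L, HasDerivAt X (X' z) z)
    (hX' : ContinuousOn X' (Set.Icc (0:ℝ) L))
    (hderiv : ∀ z ∈ Set.Icc (0:ℝ) L, ∀ᵐ κ : EuclideanSpace ℝ (Fin 2),
      (X' z : EuclideanSpace ℝ (Fin 2) → ℂ) κ =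
        Complex.I * (k : ℂ) *
          ∫ q, Complex.exp (-Complex.I *
              (((‖κ - q‖ ^ 2 - ‖κ‖ ^ 2) * z / (2 * k) : ℝ) : ℂ)) *
            ((b z q : ℝ) : ℂ) * g q *
            (X z : EuclideanSpace ℝ (Fin 2) → ℂ) (κ - q) ∂μ) :
    ∀ z ∈ Set.Icc (0:ℝ) L, ‖X z‖ = ‖X 0‖ := by
  obtain ⟨Cg, hCg⟩ := hgb
  obtain ⟨Cb, hCb⟩ := hbb
  have key : ∀ z ∈ Set.Icc (0:ℝ) L, inner ℂ (X z) (X' z) + inner ℂ (X' z) (X z) = 0 := by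
    intro z hz
    have hmem := Lp.memLp (X z)
    have hx := Lp.stronglyMeasurable (X z)
    have hx2 : Integrable (fun κ => ‖(X z : EuclideanSpace ℝ (Fin 2) → ℂ) κ‖ ^ 2) :=
      (memLp_two_iff_integrable_sq_norm hx.aestronglyMeasurable).1 hmem
    have hbz : Measurable (b z) := hbm.comp measurable_prodMk_left
    have h := aux_re μ hμsym (X z) hx hx2
      (fun q κ => Complex.exp (-Complex.I *
              (((‖κ - q‖ ^ 2 - ‖κ‖ ^ 2) * z / (2 * k) : ℝ) : ℂ)) *
            ((b z q : ℝ) : ℂ) * g q) ?_ (1 * Cb * Cg) ?_ ?_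
    · rw [← inner_conj_symm (X' z) (X z)]
      have hS : inner ℂ (X z) (X' z) = Complex.I * (k : ℂ) * 
          ∫ κ, (∫ q, Complex.exp (-Complex.I *
              (((‖κ - q‖ ^ 2 - ‖κ‖ ^ 2) * z / (2 * k) : ℝ) : ℂ)) *
            ((b z q : ℝ) : ℂ) * g q * X z (κ - q) ∂μ) * starRingEnd ℂ (X z κ) := by
        rw [L2.inner_def, ← integral_const_mul]
        refine integral_congr_ae ?_
        filter_upwards [hderiv z hz] with κ hκ
        rw [RCLike.inner_apply, hκ, mul_assoc]
      rw [hS, map_mul, h]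
      simp
    · have : Measurable fun p : EuclideanSpace ℝ (Fin 2) × EuclideanSpace ℝ (Fin 2) =>
          Complex.exp (-Complex.I *
              (((‖p.2 - p.1‖ ^ 2 - ‖p.2‖ ^ 2) * z / (2 * k) : ℝ) : ℂ)) := by
        apply Continuous.measurable
        fun_prop
      exact (this.mul (Complex.measurable_ofReal.comp (hbz.comp measurable_fst))).mul
        (hgm.comp measurable_fst)
    · intro q κ
      rw [norm_mul, norm_mul]
      have h1 : ‖Complex.exp (-Complex.I *
              (((‖κ - q‖ ^ 2 - ‖κ‖ ^ 2) * z / (2 * k) : ℝ) : ℂ))‖ = 1 := by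
        rw [Complex.norm_exp]
        simp only [neg_mul, Complex.neg_re, Complex.I_mul_re, Complex.ofReal_im]
        simp
      have h2 : ‖((b z q : ℝ) : ℂ)‖ ≤ Cb := by simpa using hCb z q
      rw [h1]
      have := norm_nonneg ((b z q : ℝ) : ℂ)
      exact mul_le_mul (mul_le_mul_of_nonneg_left h2 zero_le_one) (hCg q) (norm_nonneg _)
        (by linarith)
    · intro q κ
      rw [map_mul, map_mul, hgsym, hbsym, Complex.conj_ofReal, ← Complex.exp_conj, map_mul,
        Complex.conj_ofReal, map_neg, Complex.conj_I, sub_neg_eq_add, sub_add_cancel]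
      congr 3
      push_cast
      ring
  have hd : ∀ z ∈ Set.Icc (0:ℝ) L, HasDerivAt (fun t => inner ℂ (X t) (X t)) (0:ℂ) z := by
    intro z hz
    have := (hX z hz).inner ℂ (hX z hz)
    rwa [key z hz] at this
  have hc := constant_of_has_deriv_right_zero
    (fun z hz => (hd z hz).continuousAt.continuousWithinAt)
    (fun z hz => (hd z (Set.Ico_subset_Icc_self hz)).hasDerivWithinAt)
  intro z hz
  have h := hc z hz
  simp only [inner_self_eq_norm_sq_to_K] at h
  have h2 : ‖X z‖ ^ 2 = ‖X 0‖ ^ 2 := by exact_mod_cast h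
  exact (sq_eq_sq₀ (norm_nonneg _) (norm_nonneg _)).1 h2
end
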